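/- arXiv:2205.13910 — 2 statements merged into one kernel-verified Lean document; each statement's English description precedes it below -/
import Mathlib

section
/- Let f : ℝ^d → ℝ be Lipschitz, h > 0, ζ uniform on the ℓ1-sphere S_1^d, and U uniform on the ℓ1-ball B_1^d. Define f_h(x) = E[f(x + hU)]. Then f_h is differentiable and E[(d/(2h))(f(x + hζ) - f(x - hζ)) sign(ζ)] = ∇f_h(x) for all x ∈ ℝ^d. -/
open MeasureTheory ProbabilityTheory

noncomputable def laplaceMeasure : Measure ℝ :=
  volume.withDensity (fun w => ENNReal.ofReal ((1 / 2) * Real.exp (-|w|)))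

/-- The uniform distribution on the ℓ¹-sphere `S₁ᵈ`, realized as the law of `W/‖W‖₁`
for `W` a vector of i.i.d. mean-0 scale-1 Laplace random variables (Schechtman–Zinn). -/
noncomputable def sphereUniform (d : ℕ) : Measure (Fin d → ℝ) :=
  Measure.map (fun w => (∑ i, |w i|)⁻¹ • w) (Measure.pi fun _ : Fin d => laplaceMeasure)

/-- The uniform distribution on the open ℓ¹-ball `B₁ᵈ` in `ℝᵈ`. -/
noncomputable def uniformBall (d : ℕ) : Measure (Fin d → ℝ) :=
  ProbabilityTheory.cond volume {x | ∑ i, |x i| < 1}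

/-- The coordinatewise sign function (with `sign 0 = 1`). -/
noncomputable def signVec {d : ℕ} (x : Fin d → ℝ) : Fin d → ℝ := fun i => if x i < 0 then -1 else 1

open scoped Pointwise

noncomputable def nrm {d : ℕ} (w : Fin d → ℝ) : ℝ := ∑ i, |w i|

def bal (d : ℕ) : Set (Fin d → ℝ) := {x | nrm x < 1}

noncomputable def sg (t : ℝ) : ℝ := if t < 0 then -1 else 1

noncomputable def prj {d : ℕ} (w : Fin d → ℝ) : Fin d → ℝ := (nrm w)⁻¹ • w

lemma nrm_nonneg {d : ℕ} (w : Fin d → ℝ) : 0 ≤ nrm w :=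
  Finset.sum_nonneg fun _ _ => abs_nonneg _

lemma nrm_zero {d : ℕ} : nrm (0 : Fin d → ℝ) = 0 := by simp [nrm]

lemma nrm_smul {d : ℕ} (r : ℝ) (w : Fin d → ℝ) : nrm (r • w) = |r| * nrm w := by
  simp [nrm, abs_mul, Finset.mul_sum]

lemma nrm_neg {d : ℕ} (w : Fin d → ℝ) : nrm (-w) = nrm w := by simp [nrm]

lemma nrm_add {d : ℕ} (v w : Fin d → ℝ) : nrm (v + w) ≤ nrm v + nrm w := by
  simp only [nrm, ← Finset.sum_add_distrib]
  exact Finset.sum_le_sum fun _ _ => abs_add_le _ _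

lemma norm_le_nrm {d : ℕ} (w : Fin d → ℝ) : ‖w‖ ≤ nrm w := by
  refine (pi_norm_le_iff_of_nonneg (nrm_nonneg w)).2 fun i => ?_
  exact Finset.single_le_sum (f := fun i => |w i|) (fun _ _ => abs_nonneg _) (Finset.mem_univ i)

lemma nrm_le_norm {d : ℕ} (w : Fin d → ℝ) : nrm w ≤ d * ‖w‖ := by
  calc nrm w ≤ ∑ _i : Fin d, ‖w‖ := Finset.sum_le_sum fun i _ => norm_le_pi_norm w i
    _ = d * ‖w‖ := by simp

lemma nrm_sub_le {d : ℕ} (v w : Fin d → ℝ) : |nrm v - nrm w| ≤ d * ‖v - w‖ := by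
  have h1 := nrm_add (v - w) w
  have h2 := nrm_add (w - v) v
  have h3 : nrm (w - v) = nrm (v - w) := by rw [← nrm_neg, neg_sub]
  rw [sub_add_cancel] at h1 h2
  have h4 := nrm_le_norm (v - w)
  rw [abs_le]; constructor <;> linarith

lemma nrm_eq_zero {d : ℕ} {w : Fin d → ℝ} (h : nrm w = 0) : w = 0 := by
  have := norm_le_nrm w
  rw [h] at this
  exact norm_le_zero_iff.1 this

lemma nrm_cont {d : ℕ} : Continuous (nrm : (Fin d → ℝ) → ℝ) := by
  unfold nrm; fun_prop

lemma bal_open (d : ℕ) : IsOpen (bal d) := isOpen_lt nrm_cont continuous_const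

lemma bal_meas (d : ℕ) : MeasurableSet (bal d) := (bal_open d).measurableSet

lemma bal_finite (d : ℕ) : volume (bal d) < ⊤ := by
  refine lt_of_le_of_lt (measure_mono ?_) (measure_closedBall_lt_top (x := (0 : Fin d → ℝ)) (r := 1))
  intro x hx
  simp only [Metric.mem_closedBall, dist_zero_right]
  exact (norm_le_nrm x).trans (le_of_lt hx)

lemma bal_pos (d : ℕ) : 0 < volume (bal d) :=
  (bal_open d).measure_pos volume ⟨0, by simp [bal, nrm_zero]⟩

lemma sphere_null (d : ℕ) (hd : 0 < d) : ∀ᵐ x : Fin d → ℝ, nrm x ≠ 1 := by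
  have : Nonempty (Fin d) := ⟨⟨0, hd⟩⟩
  have h := measure_le_eq_lt (volume : Measure (Fin d → ℝ)) (g := nrm) nrm_zero nrm_neg nrm_add
    nrm_eq_zero (fun r x => (nrm_smul r x).le) 1
  have hs : {x : Fin d → ℝ | nrm x = 1} = {x | nrm x ≤ 1} \ {x | nrm x < 1} := by
    ext x; simp only [Set.mem_ofPred_eq, Set.mem_sdiff]; grind
  rw [ae_iff]
  simp only [ne_eq, not_not]
  rw [hs, measure_sdiff (show {x : Fin d → ℝ | nrm x < 1} ⊆ {x | nrm x ≤ 1} from fun x hx => le_of_lt (show nrm x < 1 from hx)) (bal_meas d).nullMeasurableSet (bal_finite d).ne, h]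
  simp

lemma coord_null (d : ℕ) (i : Fin d) : ∀ᵐ x : Fin d → ℝ, x i ≠ 0 := by
  have := Measure.pi_hyperplane (fun _ : Fin d => (volume : Measure ℝ)) i 0
  rw [ae_iff]
  simpa [volume_pi] using this

lemma prj_smul {d : ℕ} {t : ℝ} (ht : 0 < t) (w : Fin d → ℝ) : prj (t • w) = prj w := by
  simp only [prj, nrm_smul, abs_of_pos ht, smul_smul]
  congr 1
  field_simp

lemma sg_smul {t : ℝ} (ht : 0 < t) (s : ℝ) : sg (t * s) = sg s := by
  unfold sg
  simp [mul_neg_iff, ht, ht.not_gt]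

lemma smul_bal {d : ℕ} {t : ℝ} (ht : 0 < t) : t • bal d = {x | nrm x < t} := by
  ext x
  rw [Set.mem_smul_set_iff_inv_smul_mem₀ ht.ne']
  simp only [bal, Set.mem_ofPred_eq, nrm_smul, abs_of_pos (inv_pos.2 ht)]
  rw [inv_mul_lt_iff₀ ht, mul_one]

lemma setInt_homog {d : ℕ} (G : (Fin d → ℝ) → ℝ) (hG : ∀ t : ℝ, 0 < t → ∀ w, G (t • w) = G w)
    {t : ℝ} (ht : 0 < t) :
    ∫ x in {x | nrm x < t}, G x = t ^ d * ∫ x in bal d, G x := by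
  have := Measure.setIntegral_comp_smul_of_pos (volume : Measure (Fin d → ℝ)) G (bal d) ht
  simp only [hG t ht, smul_bal ht] at this
  rw [this]
  simp only [Module.finrank_fin_fun, smul_eq_mul]
  field_simp

/-- Layer-cake formula for homogeneous functions. -/
lemma layer {d : ℕ} (G : (Fin d → ℝ) → ℝ) (hG : ∀ t : ℝ, 0 < t → ∀ w, G (t • w) = G w)
    (hm : Measurable G) (K : ℝ) (hK : ∀ w, |G w| ≤ K) (η : ℝ → ℝ) (hη : Measurable η)
    (hi : IntegrableOn (fun t => t ^ d * η t) (Set.Ioi 0)) :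
    ∫ w, G w * (∫ t in Set.Ioi (nrm w), η t) = (∫ t in Set.Ioi 0, t ^ d * η t) * ∫ x in bal d, G x := by
  have hS : MeasurableSet {p : (Fin d → ℝ) × ℝ | nrm p.1 < p.2} :=
    measurableSet_lt (nrm_cont.measurable.comp measurable_fst) measurable_snd
  set F : (Fin d → ℝ) × ℝ → ℝ :=
    Set.indicator {p | nrm p.1 < p.2} (fun p => G p.1 * η p.2) with hF
  have hFm : Measurable F := ((hm.comp measurable_fst).mul (hη.comp measurable_snd)).indicator hS
  have e1 : ∀ t, (fun w => F (w, t)) = Set.indicator {x | nrm x < t} (fun w => G w * η t) := by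
    intro t; ext w; simp [hF, Set.indicator]
  have e2 : ∀ w, (fun t => F (w, t)) = Set.indicator (Set.Ioi (nrm w)) (fun t => G w * η t) := by
    intro t; ext w; simp [hF, Set.indicator]
  have mS : ∀ t, MeasurableSet {x : Fin d → ℝ | nrm x < t} := fun t =>
    (isOpen_lt nrm_cont continuous_const).measurableSet
  have hneg : ∀ t : ℝ, t ≤ 0 → {x : Fin d → ℝ | nrm x < t} = ∅ := by
    intro t ht; ext x; simp; linarith [nrm_nonneg x]
  have fin : ∀ t : ℝ, volume {x : Fin d → ℝ | nrm x < t} < ⊤ := by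
    intro t
    refine lt_of_le_of_lt (measure_mono ?_)
      (measure_closedBall_lt_top (x := (0 : Fin d → ℝ)) (r := t))
    intro x hx
    simp only [Metric.mem_closedBall, dist_zero_right]
    exact (norm_le_nrm x).trans (le_of_lt hx)
  have hFi : Integrable F (volume.prod volume) := by
    rw [integrable_prod_iff' hFm.aestronglyMeasurable]
    constructor
    · refine Filter.Eventually.of_forall fun t => ?_
      rw [e1, integrable_indicator_iff (mS t)]
      refine Measure.integrableOn_of_bounded (M := K * |η t|) (fin t).ne
        (hm.mul_const _).aestronglyMeasurable (Filter.Eventually.of_forall fun w => ?_)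
      rw [Real.norm_eq_abs, abs_mul]
      exact mul_le_mul_of_nonneg_right (hK w) (abs_nonneg _)
    · have : (fun t => ∫ w, ‖F (w, t)‖) =
          Set.indicator (Set.Ioi 0) (fun t => |t ^ d * η t| * ∫ x in bal d, |G x|) := by
        ext t
        have : (fun w => ‖F (w, t)‖) =
            Set.indicator {x | nrm x < t} (fun w => |G w| * |η t|) := by
          ext w; simp only [hF, Set.indicator, Set.mem_ofPred_eq]; split_ifs <;> simp
        rw [this, integral_indicator (mS t), integral_mul_const]
        by_cases ht : 0 < t
        · rw [setInt_homog (fun x => |G x|) (fun t ht w => by rw [hG t ht]) ht]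
          simp only [Set.indicator, Set.mem_Ioi, ht, if_true, abs_mul, abs_of_pos (pow_pos ht d)]
          ring
        · rw [hneg t (not_lt.1 ht)]
          simp [Set.indicator, ht]
      rw [this, integrable_indicator_iff measurableSet_Ioi]
      exact hi.abs.mul_const _
  have sw := integral_integral_swap (f := fun w t => F (w, t)) hFi
  have l : ∀ w, ∫ t, F (w, t) = G w * (∫ t in Set.Ioi (nrm w), η t) := by
    intro w
    rw [e2, integral_indicator measurableSet_Ioi, integral_const_mul]
  have r : (fun t => ∫ w, F (w, t)) =
      Set.indicator (Set.Ioi 0) (fun t => (t ^ d * η t) * ∫ x in bal d, G x) := by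
    ext t
    rw [e1, integral_indicator (mS t), integral_mul_const]
    by_cases ht : 0 < t
    · rw [setInt_homog G hG ht]
      simp only [Set.indicator, Set.mem_Ioi, ht, if_true]
      ring
    · rw [hneg t (not_lt.1 ht)]
      simp [Set.indicator, ht]
  simp only [l] at sw
  rw [sw, r, integral_indicator measurableSet_Ioi, integral_mul_const]

lemma layer_exp {d : ℕ} (G : (Fin d → ℝ) → ℝ) (hG : ∀ t : ℝ, 0 < t → ∀ w, G (t • w) = G w)
    (hm : Measurable G) (K : ℝ) (hK : ∀ w, |G w| ≤ K) :
    ∫ w, G w * Real.exp (-nrm w) = d.factorial * ∫ x in bal d, G x := by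
  have h0 : (0 : ℝ) < (d : ℝ) + 1 := by positivity
  have hc := Real.GammaIntegral_convergent h0
  have hg := Real.Gamma_eq_integral h0
  have e : ∀ t ∈ Set.Ioi (0 : ℝ), Real.exp (-t) * t ^ ((d : ℝ) + 1 - 1) = t ^ d * Real.exp (-t) := by
    intro t _
    rw [add_sub_cancel_right, Real.rpow_natCast, mul_comm]
  have := layer G hG hm K hK (fun t => Real.exp (-t)) (by fun_prop)
    (hc.congr_fun e measurableSet_Ioi)
  simp only [integral_exp_neg_Ioi] at this
  rw [this, ← Real.Gamma_nat_eq_factorial, hg, setIntegral_congr_fun measurableSet_Ioi e]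

lemma layer_lin {d : ℕ} (G : (Fin d → ℝ) → ℝ) (hG : ∀ t : ℝ, 0 < t → ∀ w, G (t • w) = G w)
    (hm : Measurable G) (K : ℝ) (hK : ∀ w, |G w| ≤ K) :
    ∫ w, G w * max (1 - nrm w) 0 = (1 / ((d : ℝ) + 1)) * ∫ x in bal d, G x := by
  have e : (fun t : ℝ => t ^ d * Set.indicator (Set.Iic 1) (fun _ => (1 : ℝ)) t) =
      Set.indicator (Set.Iic 1) (fun t => t ^ d) := by
    ext t; simp [Set.indicator]
  have hI : Set.Ioi (0 : ℝ) ∩ Set.Iic 1 = Set.Ioc 0 1 := rfl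
  have := layer G hG hm K hK (Set.indicator (Set.Iic 1) (fun _ => (1 : ℝ)))
    (measurable_const.indicator measurableSet_Iic) (by
      rw [e, IntegrableOn, integrable_indicator_iff measurableSet_Iic, IntegrableOn,
        Measure.restrict_restrict measurableSet_Iic, Set.inter_comm, hI]
      exact ((continuous_pow d).integrableOn_Icc (a := 0) (b := 1)).mono_set Set.Ioc_subset_Icc_self)
  rw [e] at this
  simp only [setIntegral_indicator measurableSet_Iic, Set.Ioi_inter_Iic] at this
  rw [← intervalIntegral.integral_of_le zero_le_one, integral_pow] at this
  simp at this
  rw [one_div, ← this]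

lemma exp_abs_integral : ∫ w : ℝ, (1 / 2) * Real.exp (-|w|) = 1 := by
  rw [integral_comp_abs (f := fun w => (1 / 2) * Real.exp (-w)), integral_const_mul,
    integral_exp_neg_Ioi_zero]
  norm_num

lemma exp_abs_integrable : Integrable (fun w : ℝ => (1 / 2) * Real.exp (-|w|)) :=
  integrable_of_integral_eq_one exp_abs_integral

instance : IsProbabilityMeasure laplaceMeasure := by
  refine ⟨?_⟩
  rw [laplaceMeasure, withDensity_apply _ MeasurableSet.univ, Measure.restrict_univ,
    ← ofReal_integral_eq_lintegral_ofReal exp_abs_integrable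
      (Filter.Eventually.of_forall fun x => by positivity), exp_abs_integral]
  simp

lemma prod_exp {d : ℕ} (w : Fin d → ℝ) :
    ∏ i, ((1 / 2) * Real.exp (-|w i|)) = (1 / 2) ^ d * Real.exp (-nrm w) := by
  rw [Finset.prod_mul_distrib, ← Real.exp_sum, nrm]
  simp

lemma exp_nrm_integrable (d : ℕ) :
    Integrable (fun w : Fin d → ℝ => (1 / 2) ^ d * Real.exp (-nrm w)) := by
  simp only [← prod_exp]
  exact Integrable.fintype_prod (f := fun (_ : Fin d) (w : ℝ) => (1 / 2) * Real.exp (-|w|))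
    (fun _ => exp_abs_integrable)

lemma pi_laplace (d : ℕ) : (Measure.pi fun _ : Fin d => laplaceMeasure) =
    volume.withDensity (fun w => ENNReal.ofReal ((1 / 2) ^ d * Real.exp (-nrm w))) := by
  refine Measure.pi_eq fun s hs => ?_
  have h1 : ∀ i, laplaceMeasure (s i) =
      ENNReal.ofReal (∫ w, (s i).indicator (fun w => (1 / 2) * Real.exp (-|w|)) w) := by
    intro i
    rw [laplaceMeasure, withDensity_apply _ (hs i), integral_indicator (hs i),
      ofReal_integral_eq_lintegral_ofReal exp_abs_integrable.integrableOn
      (Filter.Eventually.of_forall fun x => by positivity)]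
  have hS : MeasurableSet (Set.univ.pi s) := MeasurableSet.univ_pi hs
  rw [withDensity_apply _ hS, ← ofReal_integral_eq_lintegral_ofReal
    (exp_nrm_integrable d).integrableOn (Filter.Eventually.of_forall fun x => by positivity),
    ← integral_indicator hS]
  simp only [h1]
  rw [← ENNReal.ofReal_prod_of_nonneg, ← integral_fintype_prod_volume_eq_prod]
  · congr 2
    ext w
    by_cases hw : w ∈ Set.univ.pi s
    · rw [Set.indicator_of_mem hw, ← prod_exp]
      exact Finset.prod_congr rfl fun i _ => (Set.indicator_of_mem (hw i trivial) (fun w : ℝ => (1 / 2) * Real.exp (-|w|))).symm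
    · rw [Set.indicator_of_notMem hw]
      simp only [Set.mem_pi, Set.mem_univ, true_imp_iff, not_forall] at hw
      obtain ⟨i, hi⟩ := hw
      exact (Finset.prod_eq_zero (Finset.mem_univ i) (Set.indicator_of_notMem hi _)).symm
  · intro i _
    exact integral_nonneg fun w => Set.indicator_nonneg (fun _ _ => by positivity) _

lemma pi_laplace_integral {d : ℕ} (G : (Fin d → ℝ) → ℝ) :
    ∫ w, G w ∂(Measure.pi fun _ : Fin d => laplaceMeasure) =
      (1 / 2) ^ d * ∫ w, G w * Real.exp (-nrm w) := by
  rw [pi_laplace, integral_withDensity_eq_integral_toReal_smul, ← integral_const_mul]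
  · refine integral_congr_ae (Filter.Eventually.of_forall fun w => ?_)
    simp only [smul_eq_mul]
    rw [ENNReal.toReal_ofReal (by positivity)]
    ring
  · have := (nrm_cont (d := d)).measurable
    fun_prop
  · exact Filter.Eventually.of_forall fun w => ENNReal.ofReal_lt_top

lemma vol_eq (d : ℕ) : ((1 / 2 : ℝ) ^ d * d.factorial) = (volume (bal d)).toReal⁻¹ := by
  have h1 := pi_laplace_integral (d := d) (fun _ => 1)
  rw [layer_exp (fun _ => 1) (fun _ _ _ => rfl) measurable_const 1 (by simp)] at h1
  simp only [integral_const, smul_eq_mul, mul_one, Measure.real] at h1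
  have : (volume (bal d)).toReal ≠ 0 := (ENNReal.toReal_pos (bal_pos d).ne' (bal_finite d).ne).ne'
  field_simp
  field_simp at h1
  simp at h1
  simp
  linarith

lemma prj_meas {d : ℕ} : Measurable (prj : (Fin d → ℝ) → (Fin d → ℝ)) := by
  have := (nrm_cont (d := d)).measurable
  unfold prj; fun_prop

instance (d : ℕ) : IsProbabilityMeasure (sphereUniform d) := by
  unfold sphereUniform
  exact Measure.isProbabilityMeasure_map (prj_meas (d := d)).aemeasurable

lemma sphere_integral {d : ℕ} (Φ : (Fin d → ℝ) → ℝ) (hΦ : Measurable Φ) (K : ℝ)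
    (hK : ∀ w, |Φ (prj w)| ≤ K) :
    ∫ z, Φ z ∂sphereUniform d = (volume (bal d)).toReal⁻¹ * ∫ x in bal d, Φ (prj x) := by
  have h : sphereUniform d = Measure.map prj (Measure.pi fun _ : Fin d => laplaceMeasure) := rfl
  rw [h, integral_map prj_meas.aemeasurable hΦ.aestronglyMeasurable, pi_laplace_integral,
    layer_exp (fun w => Φ (prj w)) (fun t ht w => by rw [prj_smul ht]) (hΦ.comp prj_meas) K hK,
    ← mul_assoc, vol_eq]

lemma ball_integral {E : Type*} [NormedAddCommGroup E] [NormedSpace ℝ E]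
    {d : ℕ} (Φ : (Fin d → ℝ) → E) :
    ∫ z, Φ z ∂uniformBall d = (volume (bal d)).toReal⁻¹ • ∫ x in bal d, Φ x := by
  have h : uniformBall d = (volume (bal d))⁻¹ • volume.restrict (bal d) := rfl
  rw [h, integral_smul_measure, ENNReal.toReal_inv]

lemma norm_prj {d : ℕ} (w : Fin d → ℝ) : ‖prj w‖ ≤ 1 := by
  rw [prj, norm_smul, norm_inv, Real.norm_eq_abs, abs_of_nonneg (nrm_nonneg w)]
  have := norm_le_nrm w
  have h2 := nrm_nonneg w
  rw [inv_mul_eq_div]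
  exact div_le_one_of_le₀ this h2

lemma lip_of_abs {d : ℕ} {k : (Fin d → ℝ) → ℝ} {D : ℝ} (h : ∀ u v, |k u - k v| ≤ D * ‖u - v‖) :
    ∃ C, LipschitzWith C k := by
  refine ⟨D.toNNReal, LipschitzWith.of_dist_le_mul fun u v => ?_⟩
  rw [Real.dist_eq, dist_eq_norm]
  exact (h u v).trans (mul_le_mul_of_nonneg_right (Real.le_coe_toNNReal D) (norm_nonneg _))

noncomputable def hom1 {d : ℕ} (g : (Fin d → ℝ) → ℝ) (u : Fin d → ℝ) : ℝ := nrm u * g (prj u)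

lemma g_bound {d : ℕ} {g : (Fin d → ℝ) → ℝ} {C : NNReal} (hg : LipschitzWith C g)
    {p : Fin d → ℝ} (hp : ‖p‖ ≤ 1) : |g p| ≤ |g 0| + C := by
  have h := hg.dist_le_mul p 0
  rw [Real.dist_eq, dist_zero_right] at h
  have h2 : (C : ℝ) * ‖p‖ ≤ C * 1 := mul_le_mul_of_nonneg_left hp C.2
  have h3 := abs_sub_abs_le_abs_sub (g p) (g 0)
  linarith

lemma nrm_prj_diff {d : ℕ} (u v : Fin d → ℝ) (hu : 0 < nrm u) :
    nrm v * ‖prj u - prj v‖ ≤ (1 + d) * ‖u - v‖ := by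
  rcases (nrm_nonneg v).eq_or_lt with hv | hv
  · rw [← hv]; simp; positivity
  have e : nrm v • (prj u - prj v) = (u - v) + ((nrm v - nrm u) / nrm u) • u := by
    ext i
    simp only [prj, Pi.smul_apply, Pi.sub_apply, Pi.add_apply, smul_eq_mul]
    field_simp
    ring
  have e2 : nrm v * ‖prj u - prj v‖ = ‖nrm v • (prj u - prj v)‖ := by
    rw [norm_smul, Real.norm_eq_abs, abs_of_pos hv]
  rw [e2, e]
  refine (norm_add_le _ _).trans ?_
  rw [norm_smul, Real.norm_eq_abs, abs_div, abs_of_pos hu]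
  have h1 := norm_le_nrm u
  have h2 := nrm_sub_le v u
  rw [norm_sub_rev v u] at h2
  have h3 : |nrm v - nrm u| / nrm u * ‖u‖ ≤ |nrm v - nrm u| := by
    rw [div_mul_eq_mul_div, div_le_iff₀ hu]
    exact mul_le_mul_of_nonneg_left h1 (abs_nonneg _)
  linarith

lemma hom1_lip {d : ℕ} {g : (Fin d → ℝ) → ℝ} {C : NNReal} (hg : LipschitzWith C g) :
    ∃ D, LipschitzWith D (hom1 g) := by
  refine lip_of_abs (D := (|g 0| + C) * d + C * (1 + d)) fun u v => ?_
  have hC : (0 : ℝ) ≤ C := C.2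
  have hM : 0 ≤ |g 0| + C := by positivity
  have hb := nrm_sub_le u v
  have key : ∀ p q : Fin d → ℝ, nrm v * |g (prj u) - g (prj v)| ≤ C * (1 + d) * ‖u - v‖ →
      |hom1 g u - hom1 g v| ≤ ((|g 0| + C) * d + C * (1 + d)) * ‖u - v‖ := by
    intro _ _ h
    have e : hom1 g u - hom1 g v = (nrm u - nrm v) * g (prj u) + nrm v * (g (prj u) - g (prj v)) := by
      unfold hom1; ring
    rw [e]
    refine (abs_add_le _ _).trans ?_
    rw [abs_mul, abs_mul, abs_of_nonneg (nrm_nonneg v)]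
    have := mul_le_mul hb (g_bound hg (norm_prj u)) (abs_nonneg _) (by positivity)
    linarith
  rcases (nrm_nonneg u).eq_or_lt with hu | hu
  · have e : hom1 g u - hom1 g v = (nrm u - nrm v) * g (prj v) := by
      unfold hom1; rw [← hu]; ring
    rw [e, abs_mul]
    have := mul_le_mul hb (g_bound hg (norm_prj v)) (abs_nonneg _) (by positivity)
    have h2 : 0 ≤ C * (1 + d) * ‖u - v‖ := by positivity
    linarith
  · refine key u v ?_
    have h := hg.dist_le_mul (prj u) (prj v)
    rw [Real.dist_eq, dist_eq_norm] at h
    have h1 := nrm_prj_diff u v hu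
    calc nrm v * |g (prj u) - g (prj v)| ≤ nrm v * (C * ‖prj u - prj v‖) :=
          mul_le_mul_of_nonneg_left h (nrm_nonneg v)
      _ = C * (nrm v * ‖prj u - prj v‖) := by ring
      _ ≤ C * ((1 + d) * ‖u - v‖) := mul_le_mul_of_nonneg_left h1 hC
      _ = _ := by ring

lemma diff_bound {d : ℕ} {g : (Fin d → ℝ) → ℝ} {C : NNReal} (hg : LipschitzWith C g)
    (u : Fin d → ℝ) (hu : nrm u < 1) : |g u - hom1 g u| ≤ (|g 0| + 2 * C) * (1 - nrm u) := by
  have hC : (0 : ℝ) ≤ C := C.2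
  have e : g u - hom1 g u = (g u - g (prj u)) + (1 - nrm u) * g (prj u) := by unfold hom1; ring
  have h := hg.dist_le_mul u (prj u)
  rw [Real.dist_eq, dist_eq_norm] at h
  have h2 : ‖u - prj u‖ ≤ 1 - nrm u := by
    rcases (nrm_nonneg u).eq_or_lt with h0 | h0
    · have := nrm_eq_zero h0.symm
      subst this
      simp [prj, nrm_zero]
    · have e : u - prj u = (nrm u - 1) • prj u := by
        ext i
        simp only [prj, Pi.smul_apply, Pi.sub_apply, smul_eq_mul]
        field_simp
      rw [e, norm_smul, Real.norm_eq_abs, abs_of_neg (by linarith)]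
      have := mul_le_mul_of_nonneg_left (norm_prj u) (by linarith : 0 ≤ -(nrm u - 1))
      linarith
  rw [e]
  refine (abs_add_le _ _).trans ?_
  rw [abs_mul, abs_of_pos (by linarith : 0 < 1 - nrm u)]
  have h3 := mul_le_mul_of_nonneg_left (g_bound hg (norm_prj u)) (by linarith : 0 ≤ 1 - nrm u)
  have h4 := mul_le_mul_of_nonneg_left h2 hC
  linarith

noncomputable def kfun {d : ℕ} (g : (Fin d → ℝ) → ℝ) : (Fin d → ℝ) → ℝ :=
  Set.indicator (bal d) (fun u => g u - hom1 g u)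

lemma kfun_lip {d : ℕ} {g : (Fin d → ℝ) → ℝ} {C : NNReal} (hg : LipschitzWith C g) :
    ∃ D, LipschitzWith D (kfun g) := by
  obtain ⟨D, hD⟩ := hom1_lip hg
  have hC : (0 : ℝ) ≤ C := C.2
  have hD0 : (0 : ℝ) ≤ D := D.2
  set M : ℝ := (|g 0| + 2 * C) * d with hM
  have hM0 : 0 ≤ M := by positivity
  have out : ∀ u v, u ∈ bal d → v ∉ bal d → |kfun g u - kfun g v| ≤ (C + D + M) * ‖u - v‖ := by
    intro u v hu hv
    rw [kfun, Set.indicator_of_mem hu, Set.indicator_of_notMem hv, sub_zero]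
    have h1 := diff_bound hg u hu
    have hv' : 1 ≤ nrm v := not_lt.1 hv
    have h2 := nrm_sub_le u v
    have h3 : 1 - nrm u ≤ d * ‖u - v‖ := by linarith [neg_abs_le (nrm u - nrm v)]
    have h4 := mul_le_mul_of_nonneg_left h3 (by positivity : 0 ≤ |g 0| + 2 * C)
    have h5 : 0 ≤ (C + D : ℝ) * ‖u - v‖ := by positivity
    rw [hM]
    linarith
  refine lip_of_abs (D := C + D + M) fun u v => ?_
  by_cases hu : u ∈ bal d <;> by_cases hv : v ∈ bal d
  · rw [kfun, Set.indicator_of_mem hu, Set.indicator_of_mem hv]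
    have h1 := hg.dist_le_mul u v
    have h2 := hD.dist_le_mul u v
    rw [Real.dist_eq, dist_eq_norm] at h1 h2
    have h3 : 0 ≤ M * ‖u - v‖ := by positivity
    have e : g u - hom1 g u - (g v - hom1 g v) = (g u - g v) - (hom1 g u - hom1 g v) := by ring
    rw [e]
    refine (abs_sub _ _).trans ?_
    linarith
  · exact out u v hu hv
  · rw [abs_sub_comm, norm_sub_rev]
    exact out v u hv hu
  · rw [kfun, Set.indicator_of_notMem hu, Set.indicator_of_notMem hv]
    simp; positivity

lemma cs_of {d : ℕ} {k : (Fin d → ℝ) → ℝ} (hk : ∀ u, u ∉ bal d → k u = 0) :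
    HasCompactSupport k := by
  refine HasCompactSupport.intro (isCompact_closedBall (0 : Fin d → ℝ) 1) fun u hu => hk u ?_
  intro h
  apply hu
  simp only [Metric.mem_closedBall, dist_zero_right]
  exact (norm_le_nrm u).trans (le_of_lt h)

lemma lineDeriv_out {d : ℕ} {k : (Fin d → ℝ) → ℝ} (hk : ∀ u, u ∉ bal d → k u = 0)
    (u v : Fin d → ℝ) (hu : 1 < nrm u) : lineDeriv ℝ k u v = 0 := by
  have : k =ᶠ[nhds u] fun _ => 0 := by
    filter_upwards [(isOpen_lt continuous_const nrm_cont).mem_nhds hu] with x hx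
    exact hk x (not_lt.2 (le_of_lt hx))
  rw [this.lineDeriv_eq]
  simp [lineDeriv]

lemma lineDeriv_bound {d : ℕ} {k : (Fin d → ℝ) → ℝ} {D : NNReal} (h : LipschitzWith D k)
    (u v : Fin d → ℝ) : |lineDeriv ℝ k u v| ≤ D * ‖v‖ := norm_lineDeriv_le_of_lipschitz ℝ h

lemma lineDeriv_int {d : ℕ} {k : (Fin d → ℝ) → ℝ} {D : NNReal} (h : LipschitzWith D k)
    (v : Fin d → ℝ) : IntegrableOn (fun u => lineDeriv ℝ k u v) (bal d) :=
  Measure.integrableOn_of_bounded (bal_finite d).ne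
    (measurable_lineDeriv h.continuous).aestronglyMeasurable
    (Filter.Eventually.of_forall fun u => lineDeriv_bound h u v)

lemma step1 {d : ℕ} (hd : 0 < d) {g : (Fin d → ℝ) → ℝ} {C : NNReal} (hg : LipschitzWith C g)
    (v : Fin d → ℝ) :
    ∫ u in bal d, lineDeriv ℝ g u v = ∫ u in bal d, lineDeriv ℝ (hom1 g) u v := by
  obtain ⟨D, hD⟩ := hom1_lip hg
  obtain ⟨E, hE⟩ := kfun_lip hg
  have hk : ∀ u, u ∉ bal d → kfun g u = 0 := fun u hu => Set.indicator_of_notMem hu _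
  have h := LipschitzWith.integral_lineDeriv_mul_eq (μ := (volume : Measure (Fin d → ℝ)))
    (LipschitzWith.const (1 : ℝ)) hE (cs_of hk) (-v)
  have h0 : ∀ x, lineDeriv ℝ (fun _ : Fin d → ℝ => (1 : ℝ)) x (-v) = 0 := by
    intro x; simp [lineDeriv]
  simp only [h0, zero_mul, integral_zero, neg_neg, mul_one] at h
  have e : (fun u => lineDeriv ℝ (kfun g) u v) =ᵐ[volume]
      Set.indicator (bal d) (fun u => lineDeriv ℝ g u v - lineDeriv ℝ (hom1 g) u v) := by
    filter_upwards [sphere_null d hd, hg.ae_lineDifferentiableAt v, hD.ae_lineDifferentiableAt v]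
      with u h1 h2 h3
    by_cases hu : u ∈ bal d
    · rw [Set.indicator_of_mem hu]
      have : kfun g =ᶠ[nhds u] (g - hom1 g) := by
        filter_upwards [(bal_open d).mem_nhds hu] with x hx
        exact Set.indicator_of_mem hx _
      rw [this.lineDeriv_eq]
      exact (HasDerivAt.sub h2.hasLineDerivAt h3.hasLineDerivAt).deriv
    · rw [Set.indicator_of_notMem hu]
      exact lineDeriv_out hk u v (lt_of_le_of_ne (not_lt.1 hu) (Ne.symm h1))
  rw [integral_congr_ae e, integral_indicator (bal_meas d),
    integral_sub (lineDeriv_int hg v) (lineDeriv_int hD v)] at h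
  linarith

lemma tent_lip (d : ℕ) : ∃ D, LipschitzWith D (fun u : Fin d → ℝ => max (1 - nrm u) 0) := by
  refine lip_of_abs (D := d) fun u v => ?_
  refine (abs_max_sub_max_le_abs _ _ _).trans ?_
  have := nrm_sub_le v u
  rw [norm_sub_rev v u] at this
  have e : 1 - nrm u - (1 - nrm v) = nrm v - nrm u := by ring
  rwa [e]

lemma tent_deriv {d : ℕ} (i : Fin d) (u : Fin d → ℝ) (hu : nrm u < 1) (hi : u i ≠ 0) :
    lineDeriv ℝ (fun u : Fin d → ℝ => max (1 - nrm u) 0) u (-Pi.single i 1) = sg (u i) := by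
  have : (fun u : Fin d → ℝ => max (1 - nrm u) 0) =ᶠ[nhds u] fun u => 1 - nrm u := by
    filter_upwards [(bal_open d).mem_nhds hu] with x hx
    exact max_eq_left (sub_nonneg.2 (le_of_lt hx))
  rw [this.lineDeriv_eq]
  have e : ∀ t : ℝ, 1 - nrm (u + t • (-Pi.single i 1 : Fin d → ℝ)) =
      1 - (nrm u - |u i|) - |u i - t| := by
    intro t
    unfold nrm
    rw [← Finset.add_sum_erase _ _ (Finset.mem_univ i),
      ← Finset.add_sum_erase (a := i) (f := fun j => |u j|) _ (Finset.mem_univ i)]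
    have : ∀ j ∈ Finset.univ.erase i, |(u + t • (-Pi.single i 1 : Fin d → ℝ)) j| = |u j| := by
      intro j hj
      simp [Pi.single_eq_of_ne (Finset.ne_of_mem_erase hj)]
    rw [Finset.sum_congr rfl this]
    simp [← sub_eq_add_neg]
    ring
  rw [lineDeriv]
  simp only [e]
  have h2 : HasDerivAt (fun t : ℝ => u i - t) (-1) 0 := by
    simpa using (hasDerivAt_id (0 : ℝ)).const_sub (u i)
  have h3 : HasDerivAt (fun t : ℝ => |u i - t|) (-sg (u i)) 0 := by
    unfold sg
    split_ifs with h
    · have := (hasDerivAt_abs_neg (x := u i - 0) (by simpa using h)).comp (0 : ℝ) h2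
      rw [neg_one_mul] at this
      exact this
    · have h' : 0 < u i := lt_of_le_of_ne (not_lt.1 h) (Ne.symm hi)
      have := (hasDerivAt_abs_pos (x := u i - 0) (by simpa using h')).comp (0 : ℝ) h2
      rw [one_mul] at this
      exact this
  have := (h3.const_sub (1 - (nrm u - |u i|))).deriv
  simpa using this

lemma sg_meas : Measurable sg :=
  Measurable.ite measurableSet_Iio measurable_const measurable_const

lemma abs_sg (t : ℝ) : |sg t| = 1 := by unfold sg; split_ifs <;> simp

lemma hom1_smul {d : ℕ} (g : (Fin d → ℝ) → ℝ) {t : ℝ} (ht : 0 < t) (w : Fin d → ℝ) :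
    hom1 g (t • w) = t * hom1 g w := by
  rw [hom1, hom1, prj_smul ht, nrm_smul, abs_of_pos ht, mul_assoc]

lemma hom1_lineDeriv {d : ℕ} (g : (Fin d → ℝ) → ℝ) (v : Fin d → ℝ) {t : ℝ} (ht : 0 < t)
    (w : Fin d → ℝ) : lineDeriv ℝ (hom1 g) (t • w) v = lineDeriv ℝ (hom1 g) w v := by
  have e : (fun s : ℝ => hom1 g (t • w + s • v)) =
      fun s => t * (fun s => hom1 g (w + s • v)) (t⁻¹ * s) := by
    ext s
    simp only
    rw [← hom1_smul g ht, smul_add, smul_smul, mul_inv_cancel_left₀ ht.ne']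
  rw [lineDeriv, e, deriv_const_mul_field, deriv_comp_mul_left t⁻¹ (fun s : ℝ => hom1 g (w + s • v)) 0]
  simp only [mul_zero, smul_eq_mul, lineDeriv]
  field_simp

lemma step2 {d : ℕ} (hd : 0 < d) {g : (Fin d → ℝ) → ℝ} {C : NNReal} (hg : LipschitzWith C g)
    (i : Fin d) :
    ∫ u in bal d, lineDeriv ℝ (hom1 g) u (Pi.single i 1) =
      d * ∫ u in bal d, g (prj u) * sg (u i) := by
  obtain ⟨D, hD⟩ := hom1_lip hg
  obtain ⟨E, hE⟩ := tent_lip d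
  have ht : ∀ u : Fin d → ℝ, u ∉ bal d → max (1 - nrm u) 0 = 0 := fun u hu =>
    max_eq_right (sub_nonpos.2 (not_lt.1 hu))
  have h := LipschitzWith.integral_lineDeriv_mul_eq (μ := (volume : Measure (Fin d → ℝ)))
    hD hE (cs_of ht) (Pi.single i 1)
  rw [layer_lin (fun u => lineDeriv ℝ (hom1 g) u (Pi.single i 1))
    (fun t ht w => hom1_lineDeriv g _ ht w) (measurable_lineDeriv hD.continuous) _
    (fun w => lineDeriv_bound hD w _)] at h
  have hGm : Measurable (fun u : Fin d → ℝ => g (prj u) * sg (u i)) :=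
    (hg.continuous.measurable.comp prj_meas).mul (sg_meas.comp (measurable_pi_apply i))
  have hGb : ∀ u : Fin d → ℝ, |g (prj u) * sg (u i)| ≤ |g 0| + C := by
    intro u; rw [abs_mul, abs_sg, mul_one]; exact g_bound hg (norm_prj u)
  have hl := layer_lin (fun u : Fin d → ℝ => g (prj u) * sg (u i))
    (fun t ht w => by simp only [prj_smul ht, Pi.smul_apply, smul_eq_mul, sg_smul ht]) hGm _ hGb
  have hGi : IntegrableOn (fun u : Fin d → ℝ => g (prj u) * sg (u i)) (bal d) :=
    Measure.integrableOn_of_bounded (bal_finite d).ne hGm.aestronglyMeasurable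
      (Filter.Eventually.of_forall hGb)
  have hGi2 : IntegrableOn (fun u : Fin d → ℝ => g (prj u) * sg (u i) * max (1 - nrm u) 0)
      (bal d) := by
    refine Measure.integrableOn_of_bounded (bal_finite d).ne
      (hGm.mul hE.continuous.measurable).aestronglyMeasurable (M := |g 0| + C)
      (Filter.Eventually.of_forall fun u => ?_)
    rw [norm_mul, Real.norm_eq_abs, Real.norm_eq_abs]
    have h1 : |max (1 - nrm u) 0| ≤ 1 := by
      rw [abs_of_nonneg (le_max_right _ _)]
      exact max_le (by linarith [nrm_nonneg u]) zero_le_one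
    have := mul_le_mul (hGb u) h1 (abs_nonneg _) ((abs_nonneg _).trans (hGb u))
    linarith
  have e : (fun u => lineDeriv ℝ (fun u : Fin d → ℝ => max (1 - nrm u) 0) u (-Pi.single i 1)
      * hom1 g u) =ᵐ[volume] Set.indicator (bal d) (fun u => g (prj u) * sg (u i) -
        g (prj u) * sg (u i) * max (1 - nrm u) 0) := by
    filter_upwards [sphere_null d hd, coord_null d i] with u h1 h2
    by_cases hu : u ∈ bal d
    · have hu' : nrm u < 1 := hu
      rw [Set.indicator_of_mem hu, tent_deriv i u hu h2, max_eq_left (by linarith), hom1]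
      ring
    · rw [Set.indicator_of_notMem hu, lineDeriv_out ht u _
        (lt_of_le_of_ne (not_lt.1 hu) (Ne.symm h1)), zero_mul]
  have e3 : ∫ u in bal d, g (prj u) * sg (u i) * max (1 - nrm u) 0 =
      ∫ u, g (prj u) * sg (u i) * max (1 - nrm u) 0 := by
    refine setIntegral_eq_integral_of_forall_compl_eq_zero fun u hu => ?_
    rw [ht u hu, mul_zero]
  rw [integral_congr_ae e, integral_indicator (bal_meas d), integral_sub hGi hGi2, e3, hl] at h
  have : (0 : ℝ) < (d : ℝ) + 1 := by positivity
  field_simp at h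
  linarith

lemma stokes {d : ℕ} (hd : 0 < d) {g : (Fin d → ℝ) → ℝ} {C : NNReal} (hg : LipschitzWith C g)
    (i : Fin d) :
    ∫ u in bal d, lineDeriv ℝ g u (Pi.single i 1) =
      d * ∫ u in bal d, g (prj u) * sg (u i) := by
  rw [step1 hd hg, step2 hd hg]

lemma sg_neg {t : ℝ} (ht : t ≠ 0) : sg (-t) = -sg t := by
  unfold sg
  rcases lt_or_gt_of_ne ht with h | h
  · simp [h, h.not_gt, h.le]
  · simp [h, h.not_gt]

lemma prj_neg {d : ℕ} (w : Fin d → ℝ) : prj (-w) = -prj w := by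
  simp [prj, nrm_neg]

lemma signVec_prj {d : ℕ} (w : Fin d → ℝ) (i : Fin d) : signVec (prj w) i = sg (w i) := by
  rcases (nrm_nonneg w).eq_or_lt with h | h
  · have := nrm_eq_zero h.symm
    subst this
    simp [prj, signVec, sg]
  · exact sg_smul (inv_pos.2 h) (w i)

lemma antisym {d : ℕ} {g : (Fin d → ℝ) → ℝ} (i : Fin d) :
    ∫ u in bal d, g (-prj u) * sg (u i) = - ∫ u in bal d, g (prj u) * sg (u i) := by
  rw [← integral_indicator (bal_meas d), ← integral_indicator (bal_meas d), ← integral_neg,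
    ← integral_neg_eq_self]
  refine integral_congr_ae ?_
  filter_upwards [coord_null d i] with u hu
  by_cases hb : u ∈ bal d
  · have hb' : -u ∈ bal d := by
      change nrm (-u) < 1
      rw [nrm_neg]; exact hb
    rw [Set.indicator_of_mem hb, Set.indicator_of_mem hb', prj_neg, neg_neg, Pi.neg_apply, sg_neg hu]
    ring
  · have hb' : -u ∉ bal d := by
      change ¬ nrm (-u) < 1
      rw [nrm_neg]; exact hb
    rw [Set.indicator_of_notMem hb, Set.indicator_of_notMem hb', neg_zero]

lemma shift_lip {d : ℕ} {f : (Fin d → ℝ) → ℝ} {C : NNReal} (hf : LipschitzWith C f)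
    {h : ℝ} (hh : 0 < h) (x : Fin d → ℝ) :
    ∃ D, LipschitzWith D (fun u => f (x + h • u)) := by
  refine lip_of_abs (D := C * h) fun u v => ?_
  have := hf.dist_le_mul (x + h • u) (x + h • v)
  rw [Real.dist_eq, dist_eq_norm, add_sub_add_left_eq_sub, ← smul_sub, norm_smul, Real.norm_eq_abs,
    abs_of_pos hh] at this
  linarith

lemma shift_diff {d : ℕ} {f : (Fin d → ℝ) → ℝ} {C : NNReal} (hf : LipschitzWith C f)
    {h : ℝ} (hh : 0 < h) (x : Fin d → ℝ) :
    ∀ᵐ u : Fin d → ℝ, DifferentiableAt ℝ f (x + h • u) := by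
  obtain ⟨D, hD⟩ := shift_lip hf hh x
  filter_upwards [hD.ae_differentiableAt (μ := (volume : Measure (Fin d → ℝ)))] with u hu
  have e : f = (fun u => f (x + h • u)) ∘ (fun y => h⁻¹ • (y - x)) := by
    ext y; simp [smul_smul, hh.ne']
  rw [e]
  refine DifferentiableAt.comp _ ?_ (by fun_prop)
  simpa [smul_smul, hh.ne'] using hu

instance (d : ℕ) : IsProbabilityMeasure (uniformBall d) :=
  cond_isProbabilityMeasure_of_finite (bal_pos d).ne' (bal_finite d).ne

lemma ball_deriv {d : ℕ} {f : (Fin d → ℝ) → ℝ} {C : NNReal} (hf : LipschitzWith C f)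
    {h : ℝ} (hh : 0 < h) (x : Fin d → ℝ) :
    Integrable (fun u => fderiv ℝ f (x + h • u)) (uniformBall d) ∧
    HasFDerivAt (fun y => ∫ u, f (y + h • u) ∂uniformBall d)
      (∫ u, fderiv ℝ f (x + h • u) ∂uniformBall d) x := by
  have hac : uniformBall d ≪ volume := cond_absolutelyContinuous
  have hc := hf.continuous
  refine hasFDerivAt_integral_of_dominated_loc_of_lip (s := Set.univ) (bound := fun _ => (C : ℝ))
    Filter.univ_mem ?_ ?_ ?_ ?_ (integrable_const _) ?_
  · exact Filter.Eventually.of_forall fun y => by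
      have : Continuous fun u : Fin d → ℝ => f (y + h • u) := by fun_prop
      exact this.aestronglyMeasurable
  · have hcc : Continuous fun u : Fin d → ℝ => f (x + h • u) := by fun_prop
    obtain ⟨D, hD⟩ := shift_lip hf hh x
    refine Integrable.of_bound hcc.aestronglyMeasurable (|f (x + h • 0)| + D) ?_
    have : ∀ᵐ u ∂uniformBall d, u ∈ bal d := ae_cond_mem (bal_meas d)
    filter_upwards [this] with u hu
    exact g_bound hD ((norm_le_nrm u).trans (le_of_lt hu))
  · exact ((measurable_fderiv ℝ f).comp (by fun_prop : Measurable fun u : Fin d → ℝ => x + h • u)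
      ).aestronglyMeasurable
  · refine Filter.Eventually.of_forall fun u => LipschitzWith.lipschitzOnWith ?_
    have : Real.nnabs (C : ℝ) = C := by simp
    rw [this]
    refine LipschitzWith.of_dist_le_mul fun y z => ?_
    simpa using hf.dist_le_mul (y + h • u) (z + h • u)
  · filter_upwards [hac.ae_le (shift_diff hf hh x)] with u hu
    exact (hasFDerivAt_comp_add_right (h • u)).2 hu.hasFDerivAt

/-- (Smoothing lemma.) If `f` is Lipschitz, `h > 0`, `ζ` is uniform on the ℓ¹-sphere,
`U` uniform on the ℓ¹-ball, and `f_h(x) = E[f(x + h U)]`, then `f_h` is differentiable and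
`E[(d/(2h)) (f(x + hζ) - f(x - hζ)) sign(ζ)] = ∇f_h(x)` for every `x`. -/
theorem gradient_estimator_unbiased (d : ℕ) (hd : 0 < d)
    (f : (Fin d → ℝ) → ℝ) (hf : ∃ C, LipschitzWith C f) (h : ℝ) (hh : 0 < h) :
    Differentiable ℝ (fun x => ∫ u, f (x + h • u) ∂uniformBall d) ∧
      ∀ x : Fin d → ℝ,
        (∫ ζ, ((d : ℝ) / (2 * h) * (f (x + h • ζ) - f (x - h • ζ))) • signVec ζ
            ∂sphereUniform d) =
          fun i => fderiv ℝ (fun y => ∫ u, f (y + h • u) ∂uniformBall d) x (Pi.single i 1) := by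
  obtain ⟨C, hC⟩ := hf
  refine ⟨fun x => (ball_deriv hC hh x).2.differentiableAt, fun x => ?_⟩
  obtain ⟨D, hD⟩ := shift_lip hC hh x
  set g : (Fin d → ℝ) → ℝ := fun u => f (x + h • u) with hg
  have hgm : Measurable g := hD.continuous.measurable
  have hgneg : ∀ u, f (x - h • u) = g (-u) := by
    intro u; simp [hg, sub_eq_add_neg]
  have hgpos : ∀ u, f (x + h • u) = g u := fun u => rfl
  have hsm : ∀ i, Measurable (fun z : Fin d → ℝ => signVec z i) := fun i =>
    sg_meas.comp (measurable_pi_apply i)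
  have hm : ∀ i, Measurable (fun z : Fin d → ℝ =>
      ((d : ℝ) / (2 * h) * (g z - g (-z))) * signVec z i) := fun i =>
    ((hgm.sub (hgm.comp measurable_neg)).const_mul _).mul (hsm i)
  have hbd : ∀ i, ∀ w : Fin d → ℝ, |((d : ℝ) / (2 * h) * (g (prj w) - g (-prj w))) *
      signVec (prj w) i| ≤ (d : ℝ) / (2 * h) * (2 * (|g 0| + D)) := by
    intro i w
    rw [signVec_prj, abs_mul, abs_sg, mul_one, abs_mul,
      abs_of_nonneg (by positivity : 0 ≤ (d : ℝ) / (2 * h))]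
    refine mul_le_mul_of_nonneg_left ?_ (by positivity)
    refine (abs_sub _ _).trans ?_
    have h1 := g_bound hD (norm_prj w)
    have h2 := g_bound hD (p := -prj w) (by rw [norm_neg]; exact norm_prj w)
    linarith
  have hint : ∀ i, Integrable (fun z : Fin d → ℝ =>
      ((d : ℝ) / (2 * h) * (g z - g (-z))) * signVec z i) (sphereUniform d) := by
    intro i
    have e : sphereUniform d = Measure.map prj (Measure.pi fun _ : Fin d => laplaceMeasure) := rfl
    rw [e, integrable_map_measure (hm i).aestronglyMeasurable prj_meas.aemeasurable]
    exact Integrable.of_bound ((hm i).comp prj_meas).aestronglyMeasurable _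
      (Filter.Eventually.of_forall (hbd i))
  ext i
  simp only [hgneg, hgpos]
  rw [eval_integral (fun i => by simpa using hint i)]
  simp only [Pi.smul_apply, smul_eq_mul]
  rw [sphere_integral _ (hm i) _ (hbd i)]
  have hder : fderiv ℝ (fun y => ∫ u, f (y + h • u) ∂uniformBall d) x =
      ∫ u, fderiv ℝ f (x + h • u) ∂uniformBall d := (ball_deriv hC hh x).2.fderiv
  rw [hder, ContinuousLinearMap.integral_apply (ball_deriv hC hh x).1, ball_integral, smul_eq_mul]
  congr 1
  have hst := stokes hd hD i
  have e1 : ∫ u in bal d, lineDeriv ℝ g u (Pi.single i 1) =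
      h * ∫ u in bal d, fderiv ℝ f (x + h • u) (Pi.single i 1) := by
    rw [← integral_const_mul]
    refine integral_congr_ae (ae_restrict_of_ae ?_)
    filter_upwards [shift_diff hC hh x] with u hu
    have h1 : HasFDerivAt (fun u : Fin d → ℝ => x + h • u)
        (h • ContinuousLinearMap.id ℝ (Fin d → ℝ)) u :=
      ((hasFDerivAt_id u).const_smul h).const_add x
    have h2 : HasFDerivAt g _ u := hu.hasFDerivAt.comp u h1
    rw [(h2.hasLineDerivAt _).lineDeriv]
    simp
  have hI : ∀ k : (Fin d → ℝ) → ℝ, Measurable k → (∀ p, ‖p‖ ≤ 1 → |k p| ≤ |g 0| + D) →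
      IntegrableOn (fun u => k (prj u) * sg (u i)) (bal d) := by
    intro k hk hb
    refine Measure.integrableOn_of_bounded (bal_finite d).ne (M := |g 0| + D)
      ((hk.comp prj_meas).mul (sg_meas.comp (measurable_pi_apply i))).aestronglyMeasurable
      (Filter.Eventually.of_forall fun u => ?_)
    rw [Real.norm_eq_abs, abs_mul, abs_sg, mul_one]
    exact hb _ (norm_prj u)
  have e2 : ∫ u in bal d, ((d : ℝ) / (2 * h) * (g (prj u) - g (-prj u))) * signVec (prj u) i =
      (d : ℝ) / (2 * h) * (∫ u in bal d, g (prj u) * sg (u i) - g (-prj u) * sg (u i)) := by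
    rw [← integral_const_mul]
    congr 1
    ext u
    rw [signVec_prj]
    ring
  rw [e2, integral_sub (hI g hgm fun p hp => g_bound hD hp)
    (hI (fun p => g (-p)) (hgm.comp measurable_neg) fun p hp =>
      g_bound hD (by rw [norm_neg]; exact hp)), antisym]
  rw [e1] at hst
  field_simp
  linarith
end

section
/- Let d ≥ 3, ζ uniform on the ℓ1-sphere S_1^d, and G : ℝ^d → ℝ an L-Lipschitz function w.r.t. the ℓ2-norm. Then Var(G(ζ)) ≤ (4L^2/(d(d-2)))(1 + √(2d/(d+1)))^2, and in particular Var(G(ζ)) ≤ 12(1+√2)^2 (L/d)^2. -/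
open MeasureTheory ProbabilityTheory

lemma aux_half (h : ℝ → ℝ) (K : NNReal) (hK : LipschitzWith K h) (B : ℝ) (hB : ∀ x, |h x| ≤ B) :
    ∫ x in Set.Ioi (0:ℝ), (h x - h 0) ^ 2 * Real.exp (-x) ≤
      4 * ∫ x in Set.Ioi (0:ℝ), (deriv h x) ^ 2 * Real.exp (-x) := by
  have hexp : IntegrableOn (fun x : ℝ => Real.exp (-x)) (Set.Ioi 0) := by
    simpa using exp_neg_integrableOn_Ioi 0 (b := 1) one_pos
  have hi1 : IntegrableOn (fun x => (h x - h 0) ^ 2 * Real.exp (-x)) (Set.Ioi 0) := by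
    refine Integrable.bdd_mul (c := (2 * B) ^ 2) hexp ?_ ?_
    · have := hK.continuous
      exact (by fun_prop : Continuous fun x => (h x - h 0) ^ 2).aestronglyMeasurable
    · refine Filter.Eventually.of_forall fun x => ?_
      rw [Real.norm_eq_abs, abs_pow]
      have h1 := abs_le.1 (hB x); have h2 := abs_le.1 (hB 0)
      exact pow_le_pow_left₀ (abs_nonneg _) (abs_le.2 ⟨by linarith, by linarith⟩) 2
  have hi2 : IntegrableOn (fun x => (deriv h x) ^ 2 * Real.exp (-x)) (Set.Ioi 0) := by
    refine Integrable.bdd_mul (c := (K:ℝ) ^ 2) hexp ?_ ?_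
    · exact ((measurable_deriv h).pow_const 2).aestronglyMeasurable
    · refine Filter.Eventually.of_forall fun x => ?_
      rw [norm_pow]
      exact pow_le_pow_left₀ (norm_nonneg _) (norm_deriv_le_of_lipschitz hK) 2
  have key : ∀ R : ℝ, 0 ≤ R → ∫ x in (0:ℝ)..R, (h x - h 0) ^ 2 * Real.exp (-x) ≤
      4 * ∫ x in (0:ℝ)..R, (deriv h x) ^ 2 * Real.exp (-x) := by
    intro R hR
    have hac : AbsolutelyContinuousOnInterval (fun x => h x - h 0) 0 R := by
      have h1 : LipschitzWith K (fun x => h x - h 0) := by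
        intro x y
        simpa [edist_sub_right] using hK x y
      exact h1.lipschitzOnWith.absolutelyContinuousOnInterval
    have hac2 : AbsolutelyContinuousOnInterval (fun x => Real.exp (-x)) 0 R :=
      ContDiffOn.absolutelyContinuousOnInterval (by fun_prop)
    have hφ := (hac.mul hac).mul hac2
    have hftc := hφ.integral_deriv_eq_sub
    have hii := hφ.intervalIntegrable_deriv
    have hj1 : IntervalIntegrable (fun x => (h x - h 0) ^ 2 * Real.exp (-x)) volume 0 R :=
      (intervalIntegrable_iff_integrableOn_Ioc_of_le hR).2 (hi1.mono_set Set.Ioc_subset_Ioi_self)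
    have hj2 : IntervalIntegrable (fun x => (deriv h x) ^ 2 * Real.exp (-x)) volume 0 R :=
      (intervalIntegrable_iff_integrableOn_Ioc_of_le hR).2 (hi2.mono_set Set.Ioc_subset_Ioi_self)
    have hle : ∫ x in (0:ℝ)..R, deriv (((fun x => h x - h 0) * (fun x => h x - h 0)) *
        fun x => Real.exp (-x)) x ≤ ∫ x in (0:ℝ)..R,
          (2 * ((deriv h x) ^ 2 * Real.exp (-x)) - (1/2) * ((h x - h 0) ^ 2 * Real.exp (-x))) := by
      refine intervalIntegral.integral_mono_ae hR hii ((hj2.const_mul 2).sub (hj1.const_mul (1/2))) ?_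
      filter_upwards [hK.ae_differentiableAt (μ := volume)] with x hx
      have hd1 : HasDerivAt (fun x => h x - h 0) (deriv h x) x := hx.hasDerivAt.sub_const _
      have hd2 : HasDerivAt (fun x : ℝ => Real.exp (-x)) (Real.exp (-x) * (-1)) x :=
        (hasDerivAt_neg x).exp
      rw [((hd1.mul hd1).mul hd2).deriv]
      simp only [Pi.mul_apply]
      nlinarith [mul_nonneg (sq_nonneg (2 * deriv h x - (h x - h 0))) (Real.exp_pos (-x)).le]
    rw [hftc, intervalIntegral.integral_sub (hj2.const_mul 2) (hj1.const_mul (1/2)),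
      intervalIntegral.integral_const_mul, intervalIntegral.integral_const_mul] at hle
    have : 0 ≤ (h R - h 0) * (h R - h 0) * Real.exp (-R) :=
      mul_nonneg (mul_self_nonneg _) (Real.exp_pos _).le
    simp only [Pi.mul_apply, sub_self, zero_mul, sub_zero] at hle
    linarith
  refine le_of_tendsto_of_tendsto (intervalIntegral_tendsto_integral_Ioi 0 hi1 Filter.tendsto_id)
    ((intervalIntegral_tendsto_integral_Ioi 0 hi2 Filter.tendsto_id).const_mul 4) ?_
  filter_upwards [Filter.eventually_ge_atTop 0] with R hR using key R hR

lemma aux_half' (h : ℝ → ℝ) (K : NNReal) (hK : LipschitzWith K h) (B : ℝ) (hB : ∀ x, |h x| ≤ B) :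
    ∫⁻ x in Set.Ioi (0:ℝ), ENNReal.ofReal ((h x - h 0) ^ 2) * ENNReal.ofReal (1 / 2 * Real.exp (-x)) ≤
      4 * ∫⁻ x in Set.Ioi (0:ℝ), ENNReal.ofReal ((deriv h x) ^ 2) *
        ENNReal.ofReal (1 / 2 * Real.exp (-x)) := by
  have hexp : IntegrableOn (fun x : ℝ => Real.exp (-x)) (Set.Ioi 0) := by
    simpa using exp_neg_integrableOn_Ioi 0 (b := 1) one_pos
  have hi1 : IntegrableOn (fun x => (h x - h 0) ^ 2 * Real.exp (-x)) (Set.Ioi 0) := by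
    refine Integrable.bdd_mul (c := (2 * B) ^ 2) hexp ?_ ?_
    · have := hK.continuous
      exact (by fun_prop : Continuous fun x => (h x - h 0) ^ 2).aestronglyMeasurable
    · refine Filter.Eventually.of_forall fun x => ?_
      rw [Real.norm_eq_abs, abs_pow]
      have h1 := abs_le.1 (hB x); have h2 := abs_le.1 (hB 0)
      exact pow_le_pow_left₀ (abs_nonneg _) (abs_le.2 ⟨by linarith, by linarith⟩) 2
  have hi2 : IntegrableOn (fun x => (deriv h x) ^ 2 * Real.exp (-x)) (Set.Ioi 0) := by
    refine Integrable.bdd_mul (c := (K:ℝ) ^ 2) hexp ?_ ?_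
    · exact ((measurable_deriv h).pow_const 2).aestronglyMeasurable
    · refine Filter.Eventually.of_forall fun x => ?_
      rw [norm_pow]
      exact pow_le_pow_left₀ (norm_nonneg _) (norm_deriv_le_of_lipschitz hK) 2
  have conv : ∀ F : ℝ → ℝ, IntegrableOn (fun x => (F x) ^ 2 * Real.exp (-x)) (Set.Ioi 0) →
      ∫⁻ x in Set.Ioi (0:ℝ), ENNReal.ofReal ((F x) ^ 2) * ENNReal.ofReal (1 / 2 * Real.exp (-x))
      = ENNReal.ofReal (1 / 2 * ∫ x in Set.Ioi (0:ℝ), (F x) ^ 2 * Real.exp (-x)) := by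
    intro F hF
    rw [← integral_const_mul, ofReal_integral_eq_lintegral_ofReal (hF.const_mul _)]
    · refine lintegral_congr fun x => ?_
      rw [← ENNReal.ofReal_mul (sq_nonneg _)]
      congr 1; ring
    · exact Filter.Eventually.of_forall fun x => by positivity
  rw [conv (fun x => h x - h 0) hi1, conv (deriv h) hi2]
  rw [show (4 : ENNReal) = ENNReal.ofReal 4 by norm_num, ← ENNReal.ofReal_mul (by norm_num)]
  apply ENNReal.ofReal_le_ofReal
  have := aux_half h K hK B hB
  linarith

lemma laplace_lintegral (F : ℝ → ENNReal) (hF : Measurable F) :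
    ∫⁻ x, F x ∂laplaceMeasure =
      (∫⁻ x in Set.Ioi (0:ℝ), F x * ENNReal.ofReal (1 / 2 * Real.exp (-x))) +
      ∫⁻ x in Set.Ioi (0:ℝ), F (-x) * ENNReal.ofReal (1 / 2 * Real.exp (-x)) := by
  unfold laplaceMeasure
  rw [lintegral_withDensity_eq_lintegral_mul _ (by fun_prop) hF]
  rw [← lintegral_add_compl _ (measurableSet_Ioi (a := (0:ℝ)))]
  congr 1
  · refine setLIntegral_congr_fun measurableSet_Ioi fun x hx => ?_
    simp only [Pi.mul_apply]
    rw [abs_of_pos hx, mul_comm]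
  · rw [Set.compl_Ioi, setLIntegral_congr (Iio_ae_eq_Iic (a := (0:ℝ))).symm]
    have := (Measure.measurePreserving_neg (volume : Measure ℝ)).setLIntegral_comp_preimage_emb
      (MeasurableEquiv.neg ℝ).measurableEmbedding
      (fun x => F x * ENNReal.ofReal (1 / 2 * Real.exp (x))) (Set.Iio 0)
    have h2 : (Neg.neg ⁻¹' (Set.Iio (0:ℝ))) = Set.Ioi 0 := by ext; simp
    rw [h2] at this
    rw [this]
    refine setLIntegral_congr_fun measurableSet_Iio fun x hx => ?_
    simp only [Pi.mul_apply]
    rw [abs_of_neg hx, mul_comm, neg_neg]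

lemma gamma_lintegral (n : ℕ) (a : ℝ) (ha : 0 < a) :
    ∫⁻ x in Set.Ioi (0:ℝ), ENNReal.ofReal (x ^ n * Real.exp (-(a * x))) =
      ENNReal.ofReal (n.factorial / a ^ (n + 1)) := by
  have h := Real.integral_rpow_mul_exp_neg_mul_Ioi (a := n + 1) (r := a) (by positivity) ha
  have hint : IntegrableOn (fun x : ℝ => x ^ n * Real.exp (-(a * x))) (Set.Ioi 0) := by
    have := integrableOn_rpow_mul_exp_neg_mul_rpow (s := n) (p := 1) (b := a)
      (by have : (0:ℝ) ≤ n := by positivity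
          linarith) one_pos ha
    simpa using this
  rw [← ofReal_integral_eq_lintegral_ofReal hint]
  · congr 1
    rw [Real.Gamma_nat_eq_factorial] at h
    simp only [add_sub_cancel_right, Real.rpow_natCast] at h
    rw [h]
    rw [show ((n:ℝ) + 1) = ((n+1 : ℕ) : ℝ) by push_cast; ring, Real.rpow_natCast,
      one_div, inv_pow, div_eq_inv_mul]
  · exact (ae_restrict_iff' measurableSet_Ioi).2 (Filter.Eventually.of_forall fun x hx => by
      have : (0:ℝ) < x := hx
      positivity)

lemma laplace_moment (n : ℕ) (t : ℝ) (ht : 0 ≤ t) :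
    ∫⁻ x, ENNReal.ofReal (|x| ^ n * Real.exp (-(t * |x|))) ∂laplaceMeasure =
      ENNReal.ofReal (n.factorial / (1 + t) ^ (n + 1)) := by
  rw [laplace_lintegral _ (by fun_prop)]
  simp only [abs_neg]
  have : ∫⁻ x in Set.Ioi (0:ℝ), ENNReal.ofReal (|x| ^ n * Real.exp (-(t * |x|))) *
      ENNReal.ofReal (1 / 2 * Real.exp (-x)) =
      ENNReal.ofReal (1/2) * ENNReal.ofReal (n.factorial / (1 + t) ^ (n + 1)) := by
    rw [← gamma_lintegral n (1 + t) (by linarith), ← lintegral_const_mul _ (by fun_prop)]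
    refine setLIntegral_congr_fun measurableSet_Ioi fun x hx => ?_
    have hx' : (0:ℝ) < x := hx
    rw [abs_of_pos hx', ← ENNReal.ofReal_mul (by positivity), ← ENNReal.ofReal_mul (by positivity)]
    congr 1
    rw [show -((1 + t) * x) = -(t * x) + -x by ring, Real.exp_add]
    ring
  rw [this, ← add_mul, ← ENNReal.ofReal_add (by norm_num) (by norm_num)]
  norm_num

instance inst_s16 : IsProbabilityMeasure laplaceMeasure := by
  constructor
  have := laplace_moment 0 0 le_rfl
  simpa using this

lemma laplace_ac : laplaceMeasure ≪ volume := withDensity_absolutelyContinuous _ _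

instance : NullSingletonClass laplaceMeasure := ⟨fun x => laplace_ac (by simp)⟩

lemma laplace_poincare (h : ℝ → ℝ) (K : NNReal) (hK : LipschitzWith K h) (B : ℝ)
    (hB : ∀ x, |h x| ≤ B) :
    ENNReal.ofReal (variance h laplaceMeasure) ≤
      4 * ∫⁻ x, ENNReal.ofReal ((deriv h x) ^ 2) ∂laplaceMeasure := by
  have hc := hK.continuous
  have h1 : variance h laplaceMeasure ≤ ∫ x, (h x - h 0) ^ 2 ∂laplaceMeasure := by
    rw [← variance_sub_const hc.aestronglyMeasurable (h 0)]
    exact variance_le_expectation_sq (by fun_prop)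
  have h2 : Integrable (fun x => (h x - h 0) ^ 2) laplaceMeasure := by
    refine Integrable.of_bound (C := (2 * B) ^ 2) (by fun_prop) ?_
    refine Filter.Eventually.of_forall fun x => ?_
    rw [Real.norm_eq_abs, abs_pow]
    have h1 := abs_le.1 (hB x); have h2 := abs_le.1 (hB 0)
    exact pow_le_pow_left₀ (abs_nonneg _) (abs_le.2 ⟨by linarith, by linarith⟩) 2
  refine (ENNReal.ofReal_le_ofReal h1).trans ?_
  rw [ofReal_integral_eq_lintegral_ofReal h2 (Filter.Eventually.of_forall fun x => sq_nonneg _)]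
  have hm := measurable_deriv h
  rw [laplace_lintegral _ (by fun_prop), laplace_lintegral _ (by fun_prop), mul_add]
  have hKn : LipschitzWith K (fun x => h (-x)) := by
    intro x y; simpa [edist_neg_neg] using hK (-x) (-y)
  have e2 := aux_half' (fun x => h (-x)) K hKn B (fun x => hB _)
  simp only [deriv_comp_neg, neg_sq, neg_zero] at e2
  exact add_le_add (aux_half' h K hK B hB) e2

section tens

lemma var_prod {X Y : Type*} [MeasurableSpace X] [MeasurableSpace Y] (μ : Measure X) (ν : Measure Y)
    [IsProbabilityMeasure μ] [IsProbabilityMeasure ν] (f : X × Y → ℝ) (hf : Measurable f)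
    (B : ℝ) (hB : ∀ p, |f p| ≤ B) :
    variance f (μ.prod ν) ≤ (∫ y, variance (fun x => f (x, y)) μ ∂ν) +
      ∫ x, variance (fun y => f (x, y)) ν ∂μ := by
  have hB0 : ∀ p, f p ∈ Set.Icc (-B) B := fun p => abs_le.1 (hB p)
  set F : X → ℝ := fun x => ∫ y, f (x, y) ∂ν with hFdef
  set H : Y → ℝ := fun y => ∫ x, f (x, y) ∂μ with hHdef
  have hF : Measurable F := (hf.stronglyMeasurable.integral_prod_right').measurable
  have hH : Measurable H := (hf.stronglyMeasurable.integral_prod_left').measurable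
  have hFB : ∀ x, |F x| ≤ B := fun x => by
    have := norm_integral_le_of_norm_le_const (μ := ν) (f := fun y => f (x, y)) (C := B)
      (Filter.Eventually.of_forall fun y => hB _)
    simpa using this
  have hHB : ∀ y, |H y| ≤ B := fun y => by
    have := norm_integral_le_of_norm_le_const (μ := μ) (f := fun x => f (x, y)) (C := B)
      (Filter.Eventually.of_forall fun y => hB _)
    simpa using this
  have sqb : ∀ {a : ℝ}, |a| ≤ B → |a ^ 2| ≤ B ^ 2 := fun h => by
    rw [abs_pow]; exact pow_le_pow_left₀ (abs_nonneg _) h 2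
  have mulb : ∀ {a b : ℝ}, |a| ≤ B → |b| ≤ B → |a * b| ≤ B * B := fun h h' => by
    rw [abs_mul]; exact mul_le_mul h h' (abs_nonneg _) ((abs_nonneg _).trans h)
  have if1 : Integrable f (μ.prod ν) :=
    Integrable.of_bound hf.aestronglyMeasurable B (Filter.Eventually.of_forall hB)
  have if2 : Integrable (fun p => f p ^ 2) (μ.prod ν) :=
    Integrable.of_bound (hf.pow_const 2).aestronglyMeasurable (B^2)
      (Filter.Eventually.of_forall fun p => sqb (hB p))
  have iF1 : Integrable F μ :=
    Integrable.of_bound hF.aestronglyMeasurable B (Filter.Eventually.of_forall hFB)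
  have iH1 : Integrable H ν :=
    Integrable.of_bound hH.aestronglyMeasurable B (Filter.Eventually.of_forall hHB)
  have iF2 : Integrable (fun x => F x ^ 2) μ :=
    Integrable.of_bound (hF.pow_const 2).aestronglyMeasurable (B^2)
      (Filter.Eventually.of_forall fun p => sqb (hFB p))
  have iH2 : Integrable (fun x => H x ^ 2) ν :=
    Integrable.of_bound (hH.pow_const 2).aestronglyMeasurable (B^2)
      (Filter.Eventually.of_forall fun p => sqb (hHB p))
  set m := ∫ p, f p ∂(μ.prod ν) with hm
  have mF : ∫ x, F x ∂μ = m := by rw [hm, integral_prod _ if1]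
  have mH : ∫ y, H y ∂ν = m := by rw [hm, integral_prod_symm _ if1]
  set Q := ∫ p, f p ^ 2 ∂(μ.prod ν) with hQ
  have e1 : variance f (μ.prod ν) = Q - m ^ 2 := by
    rw [variance_eq_sub (MemLp.of_bound hf.aestronglyMeasurable B (Filter.Eventually.of_forall hB))]
    rfl
  have e2 : ∫ y, variance (fun x => f (x, y)) μ ∂ν = Q - ∫ y, H y ^ 2 ∂ν := by
    have : ∀ y, variance (fun x => f (x, y)) μ = (∫ x, f (x, y) ^ 2 ∂μ) - H y ^ 2 := fun y => by
      rw [variance_eq_sub (MemLp.of_bound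
        (by first | exact (hf.comp measurable_prodMk_left).aestronglyMeasurable | exact (hf.comp measurable_prodMk_right).aestronglyMeasurable) B
        (Filter.Eventually.of_forall fun x => hB _))]
      rfl
    simp_rw [this]
    rw [integral_sub if2.integral_prod_right iH2, hQ, integral_prod_symm _ if2]
  have e3 : ∫ x, variance (fun y => f (x, y)) ν ∂μ = Q - ∫ x, F x ^ 2 ∂μ := by
    have : ∀ x, variance (fun y => f (x, y)) ν = (∫ y, f (x, y) ^ 2 ∂ν) - F x ^ 2 := fun x => by
      rw [variance_eq_sub (MemLp.of_bound
        (by first | exact (hf.comp measurable_prodMk_left).aestronglyMeasurable | exact (hf.comp measurable_prodMk_right).aestronglyMeasurable) B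
        (Filter.Eventually.of_forall fun x => hB _))]
      rfl
    simp_rw [this]
    rw [integral_sub if2.integral_prod_left iF2, hQ, integral_prod _ if2]
  rw [e1, e2, e3]
  -- key positivity
  have ifF : Integrable (fun p : X × Y => f p * F p.1) (μ.prod ν) :=
    Integrable.of_bound (by fun_prop) (B*B) (Filter.Eventually.of_forall fun p => mulb (hB p) (hFB _))
  have ifH : Integrable (fun p : X × Y => f p * H p.2) (μ.prod ν) :=
    Integrable.of_bound (by fun_prop) (B*B) (Filter.Eventually.of_forall fun p => mulb (hB p) (hHB _))
  have iFH : Integrable (fun p : X × Y => F p.1 * H p.2) (μ.prod ν) := iF1.mul_prod iH1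
  have iFp : Integrable (fun p : X × Y => F p.1 ^ 2) (μ.prod ν) := iF2.comp_fst ν
  have iHp : Integrable (fun p : X × Y => H p.2 ^ 2) (μ.prod ν) := iH2.comp_snd μ
  have iF1p : Integrable (fun p : X × Y => F p.1) (μ.prod ν) := iF1.comp_fst ν
  have iH1p : Integrable (fun p : X × Y => H p.2) (μ.prod ν) := iH1.comp_snd μ
  have v1 : ∫ p : X × Y, f p * F p.1 ∂(μ.prod ν) = ∫ x, F x ^ 2 ∂μ := by
    rw [integral_prod _ ifF]
    refine integral_congr_ae (Filter.Eventually.of_forall fun x => ?_)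
    simp only [integral_mul_const, sq]; rfl
  have v2 : ∫ p : X × Y, f p * H p.2 ∂(μ.prod ν) = ∫ y, H y ^ 2 ∂ν := by
    rw [integral_prod_symm _ ifH]
    refine integral_congr_ae (Filter.Eventually.of_forall fun x => ?_)
    simp only [integral_mul_const, sq]; rfl
  have v3 : ∫ p : X × Y, F p.1 * H p.2 ∂(μ.prod ν) = m * m := by
    rw [integral_prod_mul, mF, mH]
  have v4 : ∫ p : X × Y, F p.1 ^ 2 ∂(μ.prod ν) = ∫ x, F x ^ 2 ∂μ := by
    rw [integral_fun_fst (fun x => F x ^ 2)]; simp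
  have v5 : ∫ p : X × Y, H p.2 ^ 2 ∂(μ.prod ν) = ∫ x, H x ^ 2 ∂ν := by
    rw [integral_fun_snd (fun x => H x ^ 2)]; simp
  have hpos : 0 ≤ ∫ p : X × Y, (f p - F p.1 - H p.2) ^ 2 ∂(μ.prod ν) :=
    integral_nonneg fun p => sq_nonneg _
  have hpos2 : m ^ 2 ≤ ∫ p : X × Y, (f p - F p.1 - H p.2) ^ 2 ∂(μ.prod ν) := by
    have hml : MemLp (fun p : X × Y => f p - F p.1 - H p.2) 2 (μ.prod ν) := by
      refine MemLp.of_bound (by fun_prop) (3 * B) (Filter.Eventually.of_forall fun p => ?_)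
      have h1 := abs_le.1 (hB p); have h2 := abs_le.1 (hFB p.1); have h3 := abs_le.1 (hHB p.2)
      exact abs_le.2 ⟨by linarith, by linarith⟩
    have hv := variance_nonneg (fun p : X × Y => f p - F p.1 - H p.2) (μ.prod ν)
    rw [variance_eq_sub hml] at hv
    have : ∫ p : X × Y, (f p - F p.1 - H p.2) ∂(μ.prod ν) = -m := by
      have j0 : Integrable (fun p : X × Y => f p - F p.1) (μ.prod ν) := if1.sub iF1p
      rw [integral_sub j0 iH1p, integral_sub if1 iF1p, integral_fun_fst, integral_fun_snd,
        mF, mH]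
      simp [← hm]
    rw [this] at hv
    simp only [Pi.pow_apply] at hv
    linarith
  have hexp : ∫ p : X × Y, (f p - F p.1 - H p.2) ^ 2 ∂(μ.prod ν) =
      Q - (∫ x, F x ^ 2 ∂μ) - (∫ y, H y ^ 2 ∂ν) + 2 * (m * m) := by
    have : ∀ p : X × Y, (f p - F p.1 - H p.2) ^ 2 = f p ^ 2 - 2 * (f p * F p.1) - 2 * (f p * H p.2)
        + F p.1 ^ 2 + H p.2 ^ 2 + 2 * (F p.1 * H p.2) := fun p => by ring
    simp_rw [this]
    have j1 : Integrable (fun p : X × Y => f p ^ 2 - 2 * (f p * F p.1)) (μ.prod ν) :=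
      if2.sub (ifF.const_mul 2)
    have j2 : Integrable (fun p : X × Y => f p ^ 2 - 2 * (f p * F p.1) - 2 * (f p * H p.2))
      (μ.prod ν) := j1.sub (ifH.const_mul 2)
    have j3 : Integrable (fun p : X × Y => f p ^ 2 - 2 * (f p * F p.1) - 2 * (f p * H p.2)
      + F p.1 ^ 2) (μ.prod ν) := j2.add iFp
    have j4 : Integrable (fun p : X × Y => f p ^ 2 - 2 * (f p * F p.1) - 2 * (f p * H p.2)
      + F p.1 ^ 2 + H p.2 ^ 2) (μ.prod ν) := j3.add iHp
    rw [integral_add j4 (iFH.const_mul 2), integral_add j3 iHp, integral_add j2 iFp,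
      integral_sub j1 (ifH.const_mul 2),
      integral_sub if2 (ifF.const_mul 2), integral_const_mul, integral_const_mul,
      integral_const_mul, v1, v2, v3, v4, v5]
    ring
  rw [hexp] at hpos2
  nlinarith

lemma var_bdd {X : Type*} [MeasurableSpace X] (μ : Measure X) [IsProbabilityMeasure μ]
    (f : X → ℝ) (hf : Measurable f) (B : ℝ) (hB : ∀ p, |f p| ≤ B) : variance f μ ≤ B ^ 2 := by
  have := variance_le_sq_of_bounded (μ := μ) (X := f) (a := -B) (b := B)
    (Filter.Eventually.of_forall fun p => abs_le.1 (hB p)) hf.aemeasurable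
  refine this.trans (le_of_eq ?_)
  ring

lemma var_meas {X Y : Type*} [MeasurableSpace X] [MeasurableSpace Y] (ν : Measure Y)
    [IsProbabilityMeasure ν] (f : X × Y → ℝ) (hf : Measurable f)
    (B : ℝ) (hB : ∀ p, |f p| ≤ B) : Measurable (fun x => variance (fun y => f (x, y)) ν) := by
  have : ∀ x, variance (fun y => f (x, y)) ν = (∫ y, f (x, y) ^ 2 ∂ν) - (∫ y, f (x, y) ∂ν) ^ 2 :=
    fun x => by
      rw [variance_eq_sub (MemLp.of_bound
        (by first | exact (hf.comp measurable_prodMk_left).aestronglyMeasurable | exact (hf.comp measurable_prodMk_right).aestronglyMeasurable) B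
        (Filter.Eventually.of_forall fun x => hB _))]
      rfl
  simp_rw [this]
  have h1 := (hf.stronglyMeasurable.integral_prod_right' (ν := ν)).measurable
  have h2 := ((hf.pow_const 2).stronglyMeasurable.integral_prod_right' (ν := ν)).measurable
  exact h2.sub (h1.pow_const 2)

lemma tensor (μ : Measure ℝ) [IsProbabilityMeasure μ] : ∀ (n : ℕ) (f : (Fin n → ℝ) → ℝ)
    (_ : Measurable f) (B : ℝ) (_ : ∀ p, |f p| ≤ B),
    variance f (Measure.pi fun _ => μ) ≤
      ∑ i, ∫ w, variance (fun x => f (Function.update w i x)) μ ∂(Measure.pi fun _ => μ) := by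
  intro n
  induction n with
  | zero =>
    intro f hf B hB
    have : f = fun _ => f 0 := by ext x; rw [Subsingleton.elim x 0]
    rw [this]
    simp [variance, evariance]
  | succ n ih =>
    intro f hf B hB
    set π := Measure.pi (fun _ : Fin n => μ)
    have mp := (measurePreserving_piFinSuccAbove (fun _ : Fin (n+1) => μ) 0).symm
    have hcons : Measurable fun p : ℝ × (Fin n → ℝ) => (Fin.cons p.1 p.2 : Fin (n+1) → ℝ) := by
      refine measurable_pi_lambda _ fun i => ?_
      refine Fin.cases ?_ (fun j => ?_) i
      · simpa using measurable_fst
      · simpa using (by fun_prop : Measurable fun c : ℝ × (Fin n → ℝ) => c.2 j)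
    have hmp : MeasurePreserving (fun p : ℝ × (Fin n → ℝ) => (Fin.cons p.1 p.2 : Fin (n+1) → ℝ))
        (μ.prod π) (Measure.pi fun _ => μ) := by
      convert mp using 1
      ext p j; refine Fin.cases ?_ (fun k => ?_) j <;> simp [MeasurableEquiv.piFinSuccAbove_symm_apply, Fin.insertNthEquiv]
    have hemb : MeasurableEmbedding
        (fun p : ℝ × (Fin n → ℝ) => (Fin.cons p.1 p.2 : Fin (n+1) → ℝ)) := by
      have := ((MeasurableEquiv.piFinSuccAbove (fun _ : Fin (n+1) => ℝ) 0).symm).measurableEmbedding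
      convert this using 1
      ext p j; refine Fin.cases ?_ (fun k => ?_) j <;> simp [MeasurableEquiv.piFinSuccAbove_symm_apply, Fin.insertNthEquiv]
    have hv : variance f (Measure.pi fun _ => μ) =
        variance (fun p : ℝ × (Fin n → ℝ) => f (Fin.cons p.1 p.2)) (μ.prod π) := by
      rw [← hmp.map_eq, variance_map hf.aemeasurable hcons.aemeasurable]
      rfl
    have hfc : Measurable fun p : ℝ × (Fin n → ℝ) => f (Fin.cons p.1 p.2) := hf.comp hcons
    have hupd : ∀ {m : ℕ} (i : Fin m), Measurable fun p : (Fin m → ℝ) × ℝ =>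
        Function.update p.1 i p.2 := by
      intro m i
      exact measurable_update'
    rw [hv]
    refine (var_prod μ π _ hfc B (fun p => hB _)).trans ?_
    rw [Fin.sum_univ_succ]
    have hI : ∀ i : Fin (n+1), ∫ w, variance (fun x => f (Function.update w i x)) μ
        ∂(Measure.pi fun _ => μ) = ∫ p : ℝ × (Fin n → ℝ), variance (fun x =>
          f (Function.update (Fin.cons p.1 p.2 : Fin (n+1) → ℝ) i x)) μ ∂(μ.prod π) := fun i =>
      (hmp.integral_comp hemb _).symm
    have hInt : ∀ i : Fin (n+1), Integrable (fun p : ℝ × (Fin n → ℝ) => variance (fun x =>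
          f (Function.update (Fin.cons p.1 p.2 : Fin (n+1) → ℝ) i x)) μ) (μ.prod π) := fun i => by
      refine Integrable.of_bound ?_ (B^2) (Filter.Eventually.of_forall fun p => ?_)
      · have := var_meas μ (fun q : (Fin (n+1) → ℝ) × ℝ => f (Function.update q.1 i q.2))
          (hf.comp (hupd i)) B (fun _ => hB _)
        exact (this.comp hcons).aestronglyMeasurable
      · rw [Real.norm_eq_abs, abs_of_nonneg (variance_nonneg _ _)]
        exact var_bdd μ _ (hf.comp (measurable_update _)) B (fun _ => hB _)
    simp_rw [hI]
    refine add_le_add ?_ ?_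
    · rw [integral_prod_symm _ (hInt 0)]
      simp [Fin.update_cons_zero]
    · calc _ ≤ ∫ x, ∑ i : Fin n, ∫ w, variance (fun y => f (Function.update
            (Fin.cons x w : Fin (n+1) → ℝ) i.succ y)) μ ∂π ∂μ := by
            refine integral_mono_of_nonneg (Filter.Eventually.of_forall fun x => variance_nonneg _ _)
              (integrable_finsetSum _ fun i _ => (hInt i.succ).integral_prod_left)
              (Filter.Eventually.of_forall fun x => ?_)
            have := ih (fun w => f (Fin.cons x w)) (hfc.comp (measurable_prodMk_left)) B
              (fun _ => hB _)
            simpa [← Fin.cons_update] using this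
        _ = _ := by
            rw [integral_finsetSum _ fun i _ => (hInt i.succ).integral_prod_left]
            refine Finset.sum_congr rfl fun i _ => ?_
            rw [integral_prod _ (hInt i.succ)]

lemma resample (μ : Measure ℝ) [IsProbabilityMeasure μ] (n : ℕ) (i : Fin n) :
    MeasurePreserving (fun p : (Fin n → ℝ) × ℝ => Function.update p.1 i p.2)
      ((Measure.pi fun _ => μ).prod μ) (Measure.pi fun _ => μ) := by
  have hm : Measurable fun p : (Fin n → ℝ) × ℝ => Function.update p.1 i p.2 := 
    measurable_update'
  refine ⟨hm, ?_⟩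
  symm
  refine Measure.pi_eq fun s hs => ?_
  rw [Measure.map_apply hm (MeasurableSet.univ_pi hs)]
  have : (fun p : (Fin n → ℝ) × ℝ => Function.update p.1 i p.2) ⁻¹' (Set.univ.pi s) =
      (Set.univ.pi (Function.update s i Set.univ)) ×ˢ (s i) := by
    ext ⟨w, x⟩
    simp only [Set.mem_preimage, Set.mem_univ_pi, Set.mem_prod]
    constructor
    · intro h
      refine ⟨fun j => ?_, by simpa using h i⟩
      by_cases hj : j = i
      · subst hj; simp
      · simpa [Function.update_of_ne hj] using h j
    · rintro ⟨h1, h2⟩ j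
      by_cases hj : j = i
      · subst hj; simpa using h2
      · simpa [Function.update_of_ne hj] using h1 j
  rw [this, Measure.prod_prod, Measure.pi_pi]
  rw [← Finset.mul_prod_erase _ _ (Finset.mem_univ i), ← Finset.mul_prod_erase _ (fun j => μ (s j)) (Finset.mem_univ i)]
  simp only [Function.update_self, measure_univ, one_mul]
  rw [mul_comm]
  congr 1
  refine Finset.prod_congr rfl fun j hj => ?_
  rw [Function.update_of_ne (Finset.ne_of_mem_erase hj)]

end tens

lemma l2_le_l1 {d : ℕ} (a : Fin d → ℝ) : Real.sqrt (∑ i, (a i) ^ 2) ≤ ∑ i, |a i| := by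
  rw [Real.sqrt_le_left (Finset.sum_nonneg fun i _ => abs_nonneg _)]
  have := Finset.sum_sq_le_sq_sum_of_nonneg (s := Finset.univ) (f := fun i => |a i|)
    (fun i _ => abs_nonneg _)
  simpa using this

lemma T_lip {d : ℕ} (w w' : Fin d → ℝ) (c : ℝ) (hc : 0 < c) (h : c ≤ ∑ i, |w i|)
    (h' : 0 < ∑ i, |w' i|) :
    Real.sqrt (∑ i, (((∑ i, |w i|)⁻¹ • w) i - ((∑ i, |w' i|)⁻¹ • w') i) ^ 2) ≤
      2 / c * ∑ i, |w i - w' i| := by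
  set S := ∑ i, |w i|
  set S' := ∑ i, |w' i|
  have hS : 0 < S := hc.trans_le h
  refine (l2_le_l1 (fun i => (S⁻¹ • w) i - (S'⁻¹ • w') i)).trans ?_
  have hSS : |S - S'| ≤ ∑ i, |w i - w' i| := by
    rw [← Finset.sum_sub_distrib]
    refine (Finset.abs_sum_le_sum_abs _ _).trans (Finset.sum_le_sum fun i _ => ?_)
    exact abs_abs_sub_abs_le_abs_sub _ _
  have h1 : ∀ i, |(S⁻¹ • w) i - (S'⁻¹ • w') i| ≤ S⁻¹ * |w i - w' i| + |w' i| * (|S - S'| * (S⁻¹ * S'⁻¹)) := by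
    intro i
    have : (S⁻¹ • w) i - (S'⁻¹ • w') i = S⁻¹ * (w i - w' i) + w' i * (-(S - S') * (S⁻¹ * S'⁻¹)) := by
      simp only [Pi.smul_apply, smul_eq_mul]
      field_simp
      ring
    rw [this]
    refine (abs_add_le _ _).trans (le_of_eq ?_)
    rw [abs_mul, abs_mul, abs_mul, abs_neg, abs_of_pos (inv_pos.2 hS),
      abs_of_pos (mul_pos (inv_pos.2 hS) (inv_pos.2 h'))]
  refine (Finset.sum_le_sum fun i _ => h1 i).trans ?_
  rw [Finset.sum_add_distrib, ← Finset.mul_sum, ← Finset.sum_mul]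
  have h2 : S' * (|S - S'| * (S⁻¹ * S'⁻¹)) = S⁻¹ * |S - S'| := by field_simp
  change S⁻¹ * _ + S' * _ ≤ _
  rw [h2]
  have h3 : S⁻¹ ≤ c⁻¹ := inv_anti₀ hc h
  have h4 : 0 ≤ ∑ i, |w i - w' i| := Finset.sum_nonneg fun i _ => abs_nonneg _
  calc _ ≤ c⁻¹ * (∑ i, |w i - w' i|) + c⁻¹ * (∑ i, |w i - w' i|) := by
        gcongr
    _ = _ := by rw [div_eq_mul_inv]; ring

lemma gram_alg {d : ℕ} (hd : 0 < d) (v z s : Fin d → ℝ) (hs : ∀ i, s i ^ 2 = 1)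
    (hz : ∑ i, s i * z i = 1) :
    ∑ i, (v i - (∑ j, s j * v j) * z i) ^ 2 ≤ d * (∑ i, z i ^ 2) * (∑ i, v i ^ 2) := by
  set q := ∑ j, s j * v j with hq
  set a := ∑ i, v i ^ 2 with ha
  set b := ∑ i, z i ^ 2 with hb
  set p := ∑ i, v i * z i with hp
  have hd' : (0:ℝ) < d := by exact_mod_cast hd
  have hc := Finset.sum_mul_sq_le_sq_mul_sq Finset.univ (fun i => v i - q / d * s i)
    (fun i => z i - 1 / d * s i)
  have e0 : ∑ i : Fin d, s i ^ 2 = d := by simp [hs]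
  have e1 : ∑ i, (v i - q / d * s i) * (z i - 1 / d * s i) = p - q / d := by
    have : ∀ i, (v i - q / d * s i) * (z i - 1 / d * s i) =
      v i * z i - 1 / d * (s i * v i) - q / d * (s i * z i) + q / d * (1 / d) * s i ^ 2 :=
      fun i => by ring
    simp_rw [this]
    rw [Finset.sum_add_distrib, Finset.sum_sub_distrib, Finset.sum_sub_distrib, ← Finset.mul_sum,
      ← Finset.mul_sum, ← Finset.mul_sum, e0, hz, ← hq, ← hp]
    field_simp
    ring
  have e2 : ∑ i, (v i - q / d * s i) ^ 2 = a - q ^ 2 / d := by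
    have : ∀ i, (v i - q / d * s i) ^ 2 =
      v i ^ 2 - 2 * q / d * (s i * v i) + (q / d) ^ 2 * s i ^ 2 :=
      fun i => by ring
    simp_rw [this]
    rw [Finset.sum_add_distrib, Finset.sum_sub_distrib, ← Finset.mul_sum,
      ← Finset.mul_sum, e0, ← hq, ← ha]
    field_simp
    ring
  have e3 : ∑ i, (z i - 1 / d * s i) ^ 2 = b - 1 / d := by
    have : ∀ i, (z i - 1 / d * s i) ^ 2 =
      z i ^ 2 - 2 / d * (s i * z i) + (1 / d) ^ 2 * s i ^ 2 :=
      fun i => by ring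
    simp_rw [this]
    rw [Finset.sum_add_distrib, Finset.sum_sub_distrib, ← Finset.mul_sum,
      ← Finset.mul_sum, e0, hz, ← hb]
    field_simp
    ring
  have e4 : ∑ i, (v i - q * z i) ^ 2 = a - 2 * q * p + q ^ 2 * b := by
    have : ∀ i, (v i - q * z i) ^ 2 = v i ^ 2 - 2 * q * (v i * z i) + q ^ 2 * z i ^ 2 :=
      fun i => by ring
    simp_rw [this]
    rw [Finset.sum_add_distrib, Finset.sum_sub_distrib, ← Finset.mul_sum,
      ← Finset.mul_sum]
  rw [e1, e2, e3] at hc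
  rw [e4]
  have h5 : (d:ℝ) * (p - q / d) ^ 2 ≤ d * ((a - q ^ 2 / d) * (b - 1 / d)) :=
    mul_le_mul_of_nonneg_left hc hd'.le
  have h6 : (d:ℝ) * (p - q / d) ^ 2 = d * p ^ 2 - 2 * p * q + q ^ 2 / d := by field_simp; ring
  have h7 : (d:ℝ) * ((a - q ^ 2 / d) * (b - 1 / d)) = d * b * a - a - q ^ 2 * b + q ^ 2 / d := by
    field_simp; ring
  rw [h6, h7] at h5
  nlinarith [mul_nonneg hd'.le (sq_nonneg p)]

lemma grad_bound {d : ℕ} (hd : 0 < d) (G : (Fin d → ℝ) → ℝ) (L : ℝ) (hL : 0 ≤ L)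
    (hG : ∀ x y, |G x - G y| ≤ L * Real.sqrt (∑ i, (x i - y i) ^ 2)) (w : Fin d → ℝ)
    (hw : ∀ i, w i ≠ 0)
    (hdf : DifferentiableAt ℝ (fun w : Fin d → ℝ => G ((∑ i, |w i|)⁻¹ • w)) w) :
    ∑ i, (fderiv ℝ (fun w : Fin d → ℝ => G ((∑ i, |w i|)⁻¹ • w)) w (Pi.single i 1)) ^ 2 ≤
      L ^ 2 * d * ∑ i, (w i) ^ 2 / (∑ i, |w i|) ^ 4 := by
  set f : (Fin d → ℝ) → ℝ := fun w => G ((∑ i, |w i|)⁻¹ • w) with hf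
  set S := ∑ i, |w i| with hSdef
  have hS : 0 < S := Finset.sum_pos (fun i _ => abs_pos.2 (hw i)) ⟨⟨0, hd⟩, Finset.mem_univ _⟩
  set v : Fin d → ℝ := fun i => fderiv ℝ f w (Pi.single i 1) with hv
  set a := ∑ i, v i ^ 2 with ha
  set s : Fin d → ℝ := fun i => (SignType.sign (w i) : ℝ) with hs
  set q := ∑ j, s j * v j with hq
  have hfv : fderiv ℝ f w v = a := by
    conv_lhs => rw [pi_eq_sum_univ' v]
    rw [map_sum, ha]
    refine Finset.sum_congr rfl fun i _ => ?_
    rw [map_smul, smul_eq_mul, sq]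
  -- derivatives along the line
  have hline : HasDerivAt (fun t : ℝ => w + t • v) v 0 := by
    simpa using ((hasDerivAt_id (0:ℝ)).smul_const v).const_add w
  have hfl : HasDerivAt (fun t : ℝ => f (w + t • v)) a 0 := by
    rw [← hfv]
    refine HasFDerivAt.comp_hasDerivAt (l := f) (0:ℝ) ?_ hline
    simpa using hdf.hasFDerivAt
  have hSl : HasDerivAt (fun t : ℝ => ∑ i, |w i + t * v i|) q 0 := by
    refine HasDerivAt.fun_sum fun i _ => ?_
    have h1 : HasDerivAt (fun t : ℝ => w i + t * v i) (v i) 0 := by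
      simpa using ((hasDerivAt_id (0:ℝ)).mul_const (v i)).const_add (w i)
    have h2 : HasDerivAt (fun x : ℝ => |x|) (s i) (w i + 0 * v i) := by
      simpa using hasDerivAt_abs (hw i)
    exact h2.comp (0:ℝ) h1
  have hTl : ∀ i, HasDerivAt (fun t : ℝ => (∑ j, |w j + t * v j|)⁻¹ * (w i + t * v i))
      (S⁻¹ * (v i - q * (w i / S))) 0 := by
    intro i
    have h1 : HasDerivAt (fun t : ℝ => w i + t * v i) (v i) 0 := by
      simpa using ((hasDerivAt_id (0:ℝ)).mul_const (v i)).const_add (w i)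
    have h2 := (hSl.fun_inv (by simpa using hS.ne')).mul h1
    refine h2.congr_deriv ?_
    simp only [zero_mul, add_zero, ← hSdef]
    field_simp
    ring
  have hlim : |a| ≤ L * Real.sqrt (∑ i, (S⁻¹ * (v i - q * (w i / S))) ^ 2) := by
    have t1 := (hasDerivAt_iff_tendsto_slope.1 hfl).abs
    have t2 : Filter.Tendsto (fun t : ℝ => L * Real.sqrt (∑ i, (slope (fun t : ℝ =>
        (∑ j, |w j + t * v j|)⁻¹ * (w i + t * v i)) 0 t) ^ 2)) (nhdsWithin 0 {0}ᶜ)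
        (nhds (L * Real.sqrt (∑ i, (S⁻¹ * (v i - q * (w i / S))) ^ 2))) := by
      refine Filter.Tendsto.const_mul _ ?_
      refine (Real.continuous_sqrt.tendsto _).comp ?_
      exact tendsto_finsetSum _ fun i _ => (hasDerivAt_iff_tendsto_slope.1 (hTl i)).pow 2
    refine le_of_tendsto_of_tendsto t1 t2 ?_
    filter_upwards [self_mem_nhdsWithin] with t ht
    have ht0 : t ≠ 0 := ht
    simp only [slope_def_field, sub_zero]
    rw [abs_div]
    simp_rw [div_pow]
    rw [← Finset.sum_div, Real.sqrt_div (Finset.sum_nonneg fun i _ => sq_nonneg _),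
      Real.sqrt_sq_eq_abs, ← mul_div_assoc]
    gcongr
    have := hG ((∑ i, |(w + t • v) i|)⁻¹ • (w + t • v)) ((∑ i, |(w + (0:ℝ) • v) i|)⁻¹ • (w + (0:ℝ) • v))
    simpa [hf] using this
  have hsz : ∑ i, s i * (w i / S) = 1 := by
    have : ∀ i, s i * (w i / S) = |w i| / S := fun i => by
      rw [← mul_div_assoc, hs]
      simp only [sign_mul_self]
    simp_rw [this]
    rw [← Finset.sum_div, div_self hS.ne']
  have hs1 : ∀ i, s i ^ 2 = 1 := fun i => by
    rcases lt_or_gt_of_ne (hw i) with h | h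
    · simp [hs, sign_neg h]
    · simp [hs, sign_pos h]
  have hga := gram_alg hd v (fun i => w i / S) s hs1 hsz
  have ha0 : 0 ≤ a := Finset.sum_nonneg fun i _ => sq_nonneg _
  have hsum : ∑ i, (S⁻¹ * (v i - q * (w i / S))) ^ 2 ≤ (S⁻¹) ^ 2 * (d * (∑ i, (w i / S) ^ 2) * a) := by
    simp_rw [mul_pow]
    rw [← Finset.mul_sum]
    exact mul_le_mul_of_nonneg_left hga (sq_nonneg _)
  have hsq : a ^ 2 ≤ L ^ 2 * ((S⁻¹) ^ 2 * (d * (∑ i, (w i / S) ^ 2) * a)) := by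
    calc a ^ 2 = |a| ^ 2 := (sq_abs a).symm
      _ ≤ (L * Real.sqrt (∑ i, (S⁻¹ * (v i - q * (w i / S))) ^ 2)) ^ 2 :=
          pow_le_pow_left₀ (abs_nonneg _) hlim 2
      _ = L ^ 2 * (∑ i, (S⁻¹ * (v i - q * (w i / S))) ^ 2) := by
          rw [mul_pow, Real.sq_sqrt (Finset.sum_nonneg fun i _ => sq_nonneg _)]
      _ ≤ _ := mul_le_mul_of_nonneg_left hsum (sq_nonneg _)
  have hfin : (S⁻¹) ^ 2 * ∑ i, (w i / S) ^ 2 = ∑ i, (w i) ^ 2 / S ^ 4 := by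
    rw [Finset.mul_sum]
    refine Finset.sum_congr rfl fun i _ => ?_
    field_simp
  rw [← hfin]
  rcases ha0.eq_or_lt with h | h
  · rw [← h]; positivity
  · have : a * a ≤ (L ^ 2 * d * ((S⁻¹) ^ 2 * ∑ i, (w i / S) ^ 2)) * a := by
      calc a * a = a ^ 2 := (sq a).symm
        _ ≤ _ := hsq
        _ = _ := by ring
    exact le_of_mul_le_mul_right this h

lemma pi_ac (μ ν : Measure ℝ) [SigmaFinite μ] [SigmaFinite ν] (h : μ ≪ ν) : ∀ n : ℕ,
    (Measure.pi fun _ : Fin n => μ) ≪ (Measure.pi fun _ : Fin n => ν) := by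
  intro n
  induction n with
  | zero => rw [Measure.pi_of_empty _ 0, Measure.pi_of_empty _ 0]
  | succ n ih =>
    have m1 := (measurePreserving_piFinSuccAbove (fun _ : Fin (n+1) => μ) 0).symm
    have m2 := (measurePreserving_piFinSuccAbove (fun _ : Fin (n+1) => ν) 0).symm
    rw [← m1.map_eq, ← m2.map_eq]
    exact (h.prod ih).map (MeasurableEquiv.measurable _)

lemma ae_diff {d : ℕ} (hd : 0 < d) (G : (Fin d → ℝ) → ℝ) (L : ℝ) (hL : 0 ≤ L)
    (hG : ∀ x y, |G x - G y| ≤ L * Real.sqrt (∑ i, (x i - y i) ^ 2)) :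
    ∀ᵐ w ∂(Measure.pi fun _ : Fin d => laplaceMeasure), (∀ i, w i ≠ 0) ∧
      DifferentiableAt ℝ (fun w : Fin d → ℝ => G ((∑ i, |w i|)⁻¹ • w)) w := by
  set f : (Fin d → ℝ) → ℝ := fun w => G ((∑ i, |w i|)⁻¹ • w) with hf
  have h0 : ∀ᵐ w ∂(Measure.pi fun _ : Fin d => laplaceMeasure), ∀ i, w i ≠ 0 :=
    ae_all_iff.2 fun i => Measure.ae_eval_ne (μ := fun _ : Fin d => laplaceMeasure) i 0
  have h1 : ∀ᵐ w : Fin d → ℝ, ∀ n : ℕ, 1 / ((n:ℝ) + 1) < ∑ i, |w i| → DifferentiableAt ℝ f w := by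
    refine ae_all_iff.2 fun n => ?_
    set U : Set (Fin d → ℝ) := {w | 1 / ((n:ℝ) + 1) < ∑ i, |w i|} with hU
    have hUo : IsOpen U := isOpen_lt continuous_const (by fun_prop)
    have hc : (0:ℝ) < 1 / ((n:ℝ) + 1) := by positivity
    have hlip : LipschitzOnWith (Real.toNNReal (L * (2 / (1 / ((n:ℝ) + 1)) * d))) f U := by
      refine LipschitzOnWith.of_dist_le_mul fun x hx y hy => ?_
      rw [Real.coe_toNNReal _ (by positivity), Real.dist_eq, mul_assoc]
      refine (hG _ _).trans (mul_le_mul_of_nonneg_left ?_ hL)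
      refine (T_lip x y _ hc (le_of_lt hx) (hc.trans hy)).trans ?_
      rw [mul_assoc]
      refine mul_le_mul_of_nonneg_left ?_ (by positivity)
      calc ∑ i, |x i - y i| ≤ ∑ i : Fin d, dist x y := Finset.sum_le_sum fun i _ => by
            rw [← Real.dist_eq]; exact dist_le_pi_dist x y i
        _ = _ := by simp
    filter_upwards [hlip.ae_differentiableWithinAt_of_mem (μ := volume)] with w hw hwU
    exact (hw hwU).differentiableAt (hUo.mem_nhds hwU)
  have h1' := (pi_ac laplaceMeasure volume laplace_ac d).ae_le h1
  filter_upwards [h0, h1'] with w hw0 hw1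
  refine ⟨hw0, ?_⟩
  have hS : 0 < ∑ i, |w i| := Finset.sum_pos (fun i _ => abs_pos.2 (hw0 i)) ⟨⟨0, hd⟩, Finset.mem_univ _⟩
  obtain ⟨n, hn⟩ := exists_nat_one_div_lt hS
  exact hw1 n hn

lemma beta_int (k : ℕ) :
    ∫⁻ t in Set.Ioi (0:ℝ), ENNReal.ofReal (t ^ 3 * (2 / (1 + t) ^ (k + 5))) =
      ENNReal.ofReal (2 * (6 / (((k:ℝ) + 1) * (k + 2) * (k + 3) * (k + 4)))) := by
  set g : ℝ → ℝ := fun t => -2 * (((1 + t)⁻¹) ^ (k + 1) / (k + 1) - 3 * ((1 + t)⁻¹) ^ (k + 2) / (k + 2)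
    + 3 * ((1 + t)⁻¹) ^ (k + 3) / (k + 3) - ((1 + t)⁻¹) ^ (k + 4) / (k + 4)) with hg
  have hder : ∀ x ∈ Set.Ici (0:ℝ), HasDerivAt g (x ^ 3 * (2 / (1 + x) ^ (k + 5))) x := by
    intro x hx
    have hx0 : (0:ℝ) ≤ x := hx
    have hx1 : (1 + x) ≠ 0 := by positivity
    have hu : HasDerivAt (fun t : ℝ => (1 + t)⁻¹) (-1 / (1 + x) ^ 2) x :=
      ((hasDerivAt_id x).const_add 1).fun_inv hx1
    have h1 := (hu.fun_pow (k + 1)).div_const ((k:ℝ) + 1)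
    have h2 := ((hu.fun_pow (k + 2)).const_mul 3).div_const ((k:ℝ) + 2)
    have h3 := ((hu.fun_pow (k + 3)).const_mul 3).div_const ((k:ℝ) + 3)
    have h4 := (hu.fun_pow (k + 4)).div_const ((k:ℝ) + 4)
    refine ((((h1.sub h2).add h3).sub h4).const_mul (-2)).congr_deriv ?_
    simp only [Nat.add_sub_cancel, Nat.cast_add, Nat.cast_one, Nat.cast_ofNat,
      show k + 2 - 1 = k + 1 by omega, show k + 3 - 1 = k + 2 by omega, show k + 4 - 1 = k + 3 by omega]
    have p1 : (k:ℝ) + 1 ≠ 0 := by positivity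
    have p2 : (k:ℝ) + 2 ≠ 0 := by positivity
    have p3 : (k:ℝ) + 3 ≠ 0 := by positivity
    have p4 : (k:ℝ) + 4 ≠ 0 := by positivity
    simp only [inv_pow]
    field_simp
    ring
  have hlim : Filter.Tendsto g Filter.atTop (nhds 0) := by
    have hu : Filter.Tendsto (fun t : ℝ => (1 + t)⁻¹) Filter.atTop (nhds 0) :=
      tendsto_inv_atTop_zero.comp (Filter.tendsto_atTop_add_const_left _ 1 Filter.tendsto_id)
    have hc : Continuous (fun u : ℝ => -2 * (u ^ (k + 1) / (k + 1) - 3 * u ^ (k + 2) / (k + 2)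
      + 3 * u ^ (k + 3) / (k + 3) - u ^ (k + 4) / ((k:ℝ) + 4))) := by fun_prop
    have := (hc.tendsto 0).comp hu
    simpa [Function.comp_def, hg] using this
  have hpos : ∀ x ∈ Set.Ioi (0:ℝ), 0 ≤ x ^ 3 * (2 / (1 + x) ^ (k + 5)) := fun x hx => by
    have : (0:ℝ) < x := hx
    positivity
  rw [← ofReal_integral_eq_lintegral_ofReal (integrableOn_Ioi_deriv_of_nonneg' hder hpos hlim)
    ((ae_restrict_iff' measurableSet_Ioi).2 (Filter.Eventually.of_forall hpos)),
    integral_Ioi_of_hasDerivAt_of_nonneg' hder hpos hlim]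
  congr 1
  simp only [hg, add_zero, inv_one, one_pow]
  field_simp
  ring

lemma moment (k : ℕ) (i : Fin (k + 3)) :
    ∫⁻ w, ENNReal.ofReal ((w i) ^ 2 / (∑ j, |w j|) ^ 4)
      ∂(Measure.pi fun _ : Fin (k + 3) => laplaceMeasure) ≤
      ENNReal.ofReal (2 / (((k:ℝ) + 1) * (k + 2) * (k + 3) * (k + 4))) := by
  set π := Measure.pi fun _ : Fin (k + 3) => laplaceMeasure
  have step : ∀ w : Fin (k + 3) → ℝ, ENNReal.ofReal ((w i) ^ 2 / (∑ j, |w j|) ^ 4) ≤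
      ENNReal.ofReal (1/6) * ∫⁻ t in Set.Ioi (0:ℝ), ENNReal.ofReal ((w i) ^ 2 *
        (t ^ 3 * Real.exp (-((∑ j, |w j|) * t)))) := by
    intro w
    have hS0 : 0 ≤ ∑ j, |w j| := Finset.sum_nonneg fun i _ => abs_nonneg _
    rcases hS0.eq_or_lt with h | h
    · rw [← h]; simp
    · apply le_of_eq
      simp_rw [ENNReal.ofReal_mul (sq_nonneg (w i))]
      rw [lintegral_const_mul _ (by fun_prop), gamma_lintegral 3 _ h, ← ENNReal.ofReal_mul (sq_nonneg _),
        ← ENNReal.ofReal_mul (by norm_num)]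
      congr 1
      simp only [Nat.factorial]
      push_cast
      field_simp
  refine (lintegral_mono step).trans ?_
  have hmeas : Measurable (fun p : (Fin (k + 3) → ℝ) × ℝ => ENNReal.ofReal ((p.1 i) ^ 2 *
        (p.2 ^ 3 * Real.exp (-((∑ j, |p.1 j|) * p.2))))) := by fun_prop
  rw [lintegral_const_mul _ (hmeas.lintegral_prod_right')]
  rw [lintegral_lintegral_swap hmeas.aemeasurable]
  have inner : ∀ t ∈ Set.Ioi (0:ℝ), ∫⁻ w : Fin (k + 3) → ℝ, ENNReal.ofReal ((w i) ^ 2 *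
        (t ^ 3 * Real.exp (-((∑ j, |w j|) * t)))) ∂π =
        ENNReal.ofReal (t ^ 3 * (2 / (1 + t) ^ (k + 5))) := by
    intro t ht
    have ht0 : (0:ℝ) < t := ht
    set X : Fin (k + 3) → ℝ → ENNReal := fun j x =>
      ENNReal.ofReal (|x| ^ (if j = i then 2 else 0) * Real.exp (-(t * |x|))) with hX
    have hXm : ∀ j, Measurable (X j) := fun j => by rw [hX]; fun_prop
    have e1 : ∀ w : Fin (k + 3) → ℝ, ENNReal.ofReal ((w i) ^ 2 *
        (t ^ 3 * Real.exp (-((∑ j, |w j|) * t)))) = ENNReal.ofReal (t ^ 3) * ∏ j, X j (w j) := by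
      intro w
      rw [hX, ← ENNReal.ofReal_prod_of_nonneg (fun j _ => by positivity),
        ← ENNReal.ofReal_mul (by positivity), Finset.prod_mul_distrib, ← Real.exp_sum]
      congr 1
      rw [Finset.prod_eq_single i (fun j _ hj => by simp [hj]) (by simp)]
      simp only [if_true, sq_abs, Finset.sum_neg_distrib, ← Finset.mul_sum]
      rw [mul_comm t]
      ring
    simp_rw [e1]
    have hpm : Measurable fun w : Fin (k + 3) → ℝ => ∏ j, X j (w j) :=
      Finset.measurable_prod _ fun j _ => (hXm j).comp (measurable_pi_apply j)
    rw [lintegral_const_mul _ hpm]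
    have hind : iIndepFun (fun j (w : Fin (k + 3) → ℝ) => X j (w j)) π :=
      iIndepFun_pi (μ := fun _ => laplaceMeasure) (fun j => (hXm j).aemeasurable)
    rw [lintegral_prod_eq_prod_lintegral_of_indepFun Finset.univ _ hind
      (fun j => (hXm j).comp (measurable_pi_apply j))]
    have e2 : ∀ j, ∫⁻ w : Fin (k + 3) → ℝ, X j (w j) ∂π =
        ENNReal.ofReal (if j = i then 2 / (1 + t) ^ 3 else 1 / (1 + t)) := by
      intro j
      have mp := measurePreserving_eval (fun _ : Fin (k + 3) => laplaceMeasure) j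
      have := mp.lintegral_comp (hXm j)
      simp only [Function.eval] at this
      rw [this, hX]
      simp only
      rw [laplace_moment _ t ht0.le]
      split_ifs <;> simp
    simp_rw [e2]
    rw [← ENNReal.ofReal_prod_of_nonneg (fun j _ => by split_ifs <;> positivity),
      ← ENNReal.ofReal_mul (by positivity)]
    congr 2
    rw [← Finset.mul_prod_erase _ _ (Finset.mem_univ i), if_pos rfl]
    rw [Finset.prod_congr rfl (g := fun _ => 1 / (1 + t)) (fun j hj => by
      rw [if_neg (Finset.ne_of_mem_erase hj)])]
    rw [Finset.prod_const, Finset.card_erase_of_mem (Finset.mem_univ _), Finset.card_univ,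
      Fintype.card_fin, show k + 3 - 1 = k + 2 by omega, one_div, inv_pow]
    have : (1 + t) ≠ 0 := by positivity
    field_simp
    ring
  rw [setLIntegral_congr_fun measurableSet_Ioi inner, beta_int, ← ENNReal.ofReal_mul (by norm_num)]
  apply ENNReal.ofReal_le_ofReal
  apply le_of_eq
  field_simp

lemma sect_var {d : ℕ} (hd : 2 ≤ d) (G : (Fin d → ℝ) → ℝ) (L : ℝ) (hL : 0 ≤ L)
    (hG : ∀ x y, |G x - G y| ≤ L * Real.sqrt (∑ i, (x i - y i) ^ 2)) (B : ℝ)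
    (hB : ∀ w : Fin d → ℝ, |G ((∑ i, |w i|)⁻¹ • w)| ≤ B) (i : Fin d) :
    ∫⁻ w, ENNReal.ofReal (variance (fun x => (fun w : Fin d → ℝ => G ((∑ i, |w i|)⁻¹ • w))
        (Function.update w i x)) laplaceMeasure) ∂(Measure.pi fun _ : Fin d => laplaceMeasure) ≤
      4 * ∫⁻ w, ENNReal.ofReal ((fderiv ℝ (fun w : Fin d → ℝ => G ((∑ i, |w i|)⁻¹ • w)) w
        (Pi.single i 1)) ^ 2) ∂(Measure.pi fun _ : Fin d => laplaceMeasure) := by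
  set f : (Fin d → ℝ) → ℝ := fun w => G ((∑ i, |w i|)⁻¹ • w) with hf
  set π := Measure.pi fun _ : Fin d => laplaceMeasure
  have had := ae_diff (by omega) G L hL hG
  have hmp := resample laplaceMeasure d i
  have had2 : ∀ᵐ w ∂π, ∀ᵐ x ∂laplaceMeasure, DifferentiableAt ℝ f (Function.update w i x) := by
    have h1 : ∀ᵐ p ∂(π.prod laplaceMeasure), DifferentiableAt ℝ f (Function.update p.1 i p.2) :=
      hmp.quasiMeasurePreserving.ae (had.mono fun w hw => hw.2)
    exact Measure.ae_ae_of_ae_prod h1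
  have hDm : Measurable fun w => ENNReal.ofReal ((fderiv ℝ f w (Pi.single i 1)) ^ 2) :=
    ((measurable_fderiv_apply_const ℝ f (Pi.single i 1)).pow_const 2).ennreal_ofReal
  have hre : ∫⁻ w, ENNReal.ofReal ((fderiv ℝ f w (Pi.single i 1)) ^ 2) ∂π =
      ∫⁻ w, ∫⁻ x, ENNReal.ofReal ((fderiv ℝ f (Function.update w i x) (Pi.single i 1)) ^ 2)
        ∂laplaceMeasure ∂π := by
    have hDm2 : Measurable fun p : (Fin d → ℝ) × ℝ =>
        ENNReal.ofReal ((fderiv ℝ f (Function.update p.1 i p.2) (Pi.single i 1)) ^ 2) :=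
      hDm.comp hmp.measurable
    rw [← hmp.lintegral_comp hDm, lintegral_prod _ hDm2.aemeasurable]
  rw [hre, ← lintegral_const_mul' _ _ (by norm_num)]
  refine lintegral_mono_ae ?_
  filter_upwards [had, had2] with w hw hw2
  obtain ⟨j, hj⟩ : ∃ j : Fin d, j ≠ i := by
    have : Nontrivial (Fin d) := Fin.nontrivial_iff_two_le.2 hd
    exact exists_ne i
  have hc : 0 < |w j| := abs_pos.2 (hw.1 j)
  have hSx : ∀ x, |w j| ≤ ∑ l, |Function.update w i x l| := fun x => by
    have := Finset.single_le_sum (f := fun l => |Function.update w i x l|)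
      (fun l _ => abs_nonneg _) (Finset.mem_univ j)
    simpa [Function.update_of_ne hj] using this
  have hlip : LipschitzWith (Real.toNNReal (L * (2 / |w j|))) (fun x => f (Function.update w i x)) := by
    refine LipschitzWith.of_dist_le_mul fun x y => ?_
    rw [Real.coe_toNNReal _ (by positivity), Real.dist_eq, mul_assoc]
    refine (hG _ _).trans (mul_le_mul_of_nonneg_left ?_ hL)
    refine (T_lip _ _ _ hc (hSx x) (hc.trans_le (hSx y))).trans (le_of_eq ?_)
    congr 1
    rw [Finset.sum_eq_single i (fun l _ hl => by simp [Function.update_of_ne hl]) (by simp)]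
    simp [Real.dist_eq]
  refine (laplace_poincare _ _ hlip B (fun x => hB _)).trans (le_of_eq ?_)
  congr 1
  refine lintegral_congr_ae ?_
  filter_upwards [hw2] with x hx
  have : HasDerivAt (fun x => f (Function.update w i x))
      (fderiv ℝ f (Function.update w i x) (Pi.single i 1)) x :=
    hx.hasFDerivAt.comp_hasDerivAt x (hasDerivAt_update w i x)
  rw [this.deriv]

lemma main_bound (k : ℕ) (G : (Fin (k+3) → ℝ) → ℝ) (L : ℝ) (hL : 0 ≤ L)
    (hG : ∀ x y, |G x - G y| ≤ L * Real.sqrt (∑ i, (x i - y i) ^ 2)) :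
    variance G (sphereUniform (k+3)) ≤ 8 * L ^ 2 * ((k:ℝ) + 3) / ((k + 1) * (k + 2) * (k + 4)) := by
  set f : (Fin (k+3) → ℝ) → ℝ := fun w => G ((∑ i, |w i|)⁻¹ • w) with hf
  set π := Measure.pi fun _ : Fin (k+3) => laplaceMeasure with hπ
  have hGc : Continuous G := by
    have : LipschitzWith (Real.toNNReal (L * (k+3))) G := by
      refine LipschitzWith.of_dist_le_mul fun x y => ?_
      rw [Real.coe_toNNReal _ (by positivity), Real.dist_eq, mul_assoc]
      refine (hG _ _).trans (mul_le_mul_of_nonneg_left ?_ hL)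
      refine (l2_le_l1 fun i => x i - y i).trans ?_
      calc ∑ i, |x i - y i| ≤ ∑ i : Fin (k+3), dist x y := Finset.sum_le_sum fun i _ => by
            rw [← Real.dist_eq]; exact dist_le_pi_dist x y i
        _ = _ := by simp
    exact this.continuous
  have hTm : Measurable fun w : Fin (k+3) → ℝ => (∑ i, |w i|)⁻¹ • w := by fun_prop
  have hfm : Measurable f := hGc.measurable.comp hTm
  have hB : ∀ w, |f w| ≤ |G 0| + L := by
    intro w
    have h1 := hG ((∑ i, |w i|)⁻¹ • w) 0
    have h2 : Real.sqrt (∑ i, (((∑ i, |w i|)⁻¹ • w) i - (0 : Fin (k+3) → ℝ) i) ^ 2) ≤ 1 := by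
      refine (l2_le_l1 fun i => ((∑ i, |w i|)⁻¹ • w) i - (0 : Fin (k+3) → ℝ) i).trans ?_
      have hS0 : 0 ≤ ∑ j, |w j| := Finset.sum_nonneg fun i _ => abs_nonneg _
      simp only [Pi.smul_apply, smul_eq_mul, Pi.zero_apply, sub_zero, abs_mul, ← Finset.mul_sum,
        abs_inv, abs_of_nonneg hS0]
      exact inv_mul_le_one
    have h3 : L * Real.sqrt (∑ i, (((∑ i, |w i|)⁻¹ • w) i - (0 : Fin (k+3) → ℝ) i) ^ 2) ≤ L * 1 :=
      mul_le_mul_of_nonneg_left h2 hL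
    have h4 : |f w| ≤ |f w - G 0| + |G 0| := by
      have := abs_add_le (f w - G 0) (G 0)
      simpa using this
    have h5 : |f w - G 0| ≤ L := by
      refine h1.trans ?_
      linarith
    linarith
  have hvar : variance G (sphereUniform (k+3)) = variance f π := by
    unfold sphereUniform
    rw [variance_map hGc.aemeasurable hTm.aemeasurable]
    rfl
  rw [hvar]
  have htens := tensor laplaceMeasure (k+3) f hfm _ hB
  have hnn : 0 ≤ 8 * L ^ 2 * ((k:ℝ) + 3) / ((k + 1) * (k + 2) * (k + 4)) := by positivity
  rw [← ENNReal.ofReal_le_ofReal_iff hnn]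
  have hint : ∀ i, ENNReal.ofReal (∫ w, variance (fun x => f (Function.update w i x)) laplaceMeasure ∂π)
      = ∫⁻ w, ENNReal.ofReal (variance (fun x => f (Function.update w i x)) laplaceMeasure) ∂π := by
    intro i
    refine ofReal_integral_eq_lintegral_ofReal ?_
      (Filter.Eventually.of_forall fun w => variance_nonneg _ _)
    refine Integrable.of_bound ?_ ((|G 0| + L)^2) (Filter.Eventually.of_forall fun p => ?_)
    · exact (var_meas laplaceMeasure (fun q : (Fin (k+3) → ℝ) × ℝ => f (Function.update q.1 i q.2))
          (hfm.comp measurable_update') _ (fun _ => hB _)).aestronglyMeasurable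
    · rw [Real.norm_eq_abs, abs_of_nonneg (variance_nonneg _ _)]
      exact var_bdd _ _ (hfm.comp (measurable_update _)) _ (fun _ => hB _)
  have hDm : ∀ i, Measurable fun w => ENNReal.ofReal ((fderiv ℝ f w (Pi.single i 1)) ^ 2) := fun i =>
    ((measurable_fderiv_apply_const ℝ f (Pi.single i 1)).pow_const 2).ennreal_ofReal
  calc ENNReal.ofReal (variance f π)
      ≤ ENNReal.ofReal (∑ i, ∫ w, variance (fun x => f (Function.update w i x)) laplaceMeasure ∂π) :=
        ENNReal.ofReal_le_ofReal htens
    _ = ∑ i, ∫⁻ w, ENNReal.ofReal (variance (fun x => f (Function.update w i x)) laplaceMeasure) ∂π := by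
        rw [ENNReal.ofReal_sum_of_nonneg fun i _ => integral_nonneg fun w => variance_nonneg _ _]
        exact Finset.sum_congr rfl fun i _ => hint i
    _ ≤ ∑ i, 4 * ∫⁻ w, ENNReal.ofReal ((fderiv ℝ f w (Pi.single i 1)) ^ 2) ∂π :=
        Finset.sum_le_sum fun i _ => sect_var (by omega) G L hL hG _ hB i
    _ = 4 * ∫⁻ w, ENNReal.ofReal (∑ i, (fderiv ℝ f w (Pi.single i 1)) ^ 2) ∂π := by
        rw [← Finset.mul_sum, ← lintegral_finsetSum _ fun i _ => hDm i]
        congr 1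
        refine lintegral_congr fun w => ?_
        rw [ENNReal.ofReal_sum_of_nonneg fun i _ => sq_nonneg _]
    _ ≤ 4 * ∫⁻ w, ENNReal.ofReal (L ^ 2 * ((k:ℝ) + 3)) *
          ∑ i, ENNReal.ofReal ((w i) ^ 2 / (∑ j, |w j|) ^ 4) ∂π := by
        gcongr 4 * ?_
        refine lintegral_mono_ae ?_
        filter_upwards [ae_diff (by omega) G L hL hG] with w hw
        rw [← ENNReal.ofReal_sum_of_nonneg fun i _ => by positivity,
          ← ENNReal.ofReal_mul (by positivity)]
        apply ENNReal.ofReal_le_ofReal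
        have := grad_bound (by omega) G L hL hG w hw.1 hw.2
        push_cast at this
        exact this
    _ = 4 * (ENNReal.ofReal (L ^ 2 * ((k:ℝ) + 3)) *
          ∑ i, ∫⁻ w, ENNReal.ofReal ((w i) ^ 2 / (∑ j, |w j|) ^ 4) ∂π) := by
        rw [lintegral_const_mul _ (by fun_prop), lintegral_finsetSum _ fun i _ => by fun_prop]
    _ ≤ 4 * (ENNReal.ofReal (L ^ 2 * ((k:ℝ) + 3)) *
          ∑ i : Fin (k+3), ENNReal.ofReal (2 / (((k:ℝ) + 1) * (k + 2) * (k + 3) * (k + 4)))) := by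
        gcongr with i
        exact moment k i
    _ = _ := by
        rw [← ENNReal.ofReal_sum_of_nonneg fun i _ => by positivity,
          ← ENNReal.ofReal_mul (by positivity), show (4 : ENNReal) = ENNReal.ofReal 4 by norm_num,
          ← ENNReal.ofReal_mul (by norm_num)]
        congr 1
        rw [Finset.sum_const, Finset.card_univ, Fintype.card_fin, nsmul_eq_mul]
        push_cast
        field_simp
        ring

/-- Let `d ≥ 3`, `ζ` uniform on the ℓ¹-sphere, and `G : ℝᵈ → ℝ` an `L`-Lipschitz function
w.r.t. the ℓ₂ norm. Then `Var(G(ζ)) ≤ (4L²/(d(d-2)))(1 + √(2d/(d+1)))²`, and in particular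
`Var(G(ζ)) ≤ 12 (1+√2)² (L/d)²`. -/
theorem variance_lipschitz_l1_sphere (d : ℕ) (hd : 3 ≤ d)
    (G : (Fin d → ℝ) → ℝ) (L : ℝ) (hL : 0 ≤ L)
    (hG : ∀ x y, |G x - G y| ≤ L * Real.sqrt (∑ i, (x i - y i) ^ 2)) :
    variance G (sphereUniform d) ≤
        4 * L ^ 2 / ((d : ℝ) * ((d : ℝ) - 2)) *
          (1 + Real.sqrt (2 * d / ((d : ℝ) + 1))) ^ 2 ∧
      variance G (sphereUniform d) ≤ 12 * (1 + Real.sqrt 2) ^ 2 * (L / d) ^ 2 := by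
  obtain ⟨k, rfl⟩ : ∃ k, d = k + 3 := ⟨d - 3, by omega⟩
  have hm := main_bound k G L hL hG
  push_cast
  have hk : (0:ℝ) ≤ k := Nat.cast_nonneg k
  have key : variance G (sphereUniform (k+3)) ≤ 4 * L ^ 2 / (((k:ℝ) + 3) * ((k:ℝ) + 3 - 2)) *
          (1 + Real.sqrt (2 * ((k:ℝ) + 3) / ((k:ℝ) + 3 + 1))) ^ 2 := by
    refine hm.trans ?_
    set a := 2 * ((k:ℝ) + 3) / ((k:ℝ) + 3 + 1) with ha
    have ha0 : 0 ≤ a := by positivity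
    have h1 : 1 + a ≤ (1 + Real.sqrt a) ^ 2 := by
      have := Real.sqrt_nonneg a
      nlinarith [Real.sq_sqrt ha0]
    have hp : (0:ℝ) < (k:ℝ) + 3 - 2 := by linarith
    have h2 : 8 * L ^ 2 * ((k:ℝ) + 3) / ((k + 1) * (k + 2) * (k + 4)) =
        4 * L ^ 2 / (((k:ℝ) + 3) * ((k:ℝ) + 3 - 2)) * (2 * (k + 3) ^ 2 / ((k + 2) * (k + 4))) := by
      rw [show (k:ℝ) + 3 - 2 = k + 1 by ring]
      field_simp
      ring
    rw [h2]
    refine mul_le_mul_of_nonneg_left (le_trans ?_ h1) (by positivity)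
    rw [ha, show (k:ℝ) + 3 + 1 = k + 4 by ring, div_le_iff₀ (by positivity)]
    have : (1 + 2 * ((k:ℝ) + 3) / (k + 4)) * ((k + 2) * (k + 4)) = (k + 4 + 2 * (k + 3)) * (k + 2) := by
      field_simp
    rw [this]
    nlinarith
  refine ⟨key, key.trans ?_⟩
  have hp : (0:ℝ) < (k:ℝ) + 3 - 2 := by linarith
  have h1 : Real.sqrt (2 * ((k:ℝ) + 3) / ((k:ℝ) + 3 + 1)) ≤ Real.sqrt 2 := by
    apply Real.sqrt_le_sqrt
    rw [div_le_iff₀ (by positivity)]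
    linarith
  have h2 : 4 * L ^ 2 / (((k:ℝ) + 3) * ((k:ℝ) + 3 - 2)) ≤ 12 * (L / (k + 3)) ^ 2 := by
    rw [div_pow, ← mul_div_assoc, div_le_div_iff₀ (by positivity) (by positivity)]
    have : (0:ℝ) ≤ L ^ 2 * (k + 3) * (8 * k) := by positivity
    nlinarith
  calc _ ≤ 12 * (L / (k + 3)) ^ 2 * (1 + Real.sqrt 2) ^ 2 := by gcongr
    _ = _ := by ring
end
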